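/- Let P be a combinatorially two-orbit convex d-polytope of class 2_I. Then either I = {0, 1, …, d−2}, or I = {1, 2, …, d−1}, or d = 4 and I = {1, 2}. -/

import Mathlib

/-! Generic definitions about flags, flag orbits, and abstract polytopes. -/

variable {α : Type*} [PartialOrder α]

/-- Two flags (maximal chains) are in the same orbit of the automorphism group
(the group of order automorphisms) if some order automorphism maps one onto the other. -/
def SameFlagOrbit (Φ Ψ : Flag α) : Prop :=
  ∃ γ : α ≃o α, γ '' (Φ : Set α) = (Ψ : Set α)

/-- The automorphism group has exactly two orbits on the flags. -/
def TwoFlagOrbits (α : Type*) [PartialOrder α] : Prop :=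
  ∃ Φ Ψ : Flag α, ¬ SameFlagOrbit Φ Ψ ∧
    ∀ Ω : Flag α, SameFlagOrbit Ω Φ ∨ SameFlagOrbit Ω Ψ

/-- `Ψ` is the flag `Φ^i`: it differs from `Φ` in exactly the rank-`i` element
(with respect to the rank function `rk`). -/
def IsIAdjacent (rk : α → ℤ) (i : ℤ) (Φ Ψ : Flag α) : Prop :=
  Φ ≠ Ψ ∧ ∀ x : α, rk x ≠ i → (x ∈ Φ ↔ x ∈ Ψ)

/-- A two-orbit polytope (with rank function `rk`, adjacency indices `0, …, n-1`)
is in class `2_I` if, for every flag `Φ` and every `i < n`, the `i`-adjacent flag `Φ^i`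
lies in the same orbit as `Φ` exactly when `i ∈ I`. -/
def InClass (rk : α → ℤ) (n : ℕ) (I : Set ℕ) : Prop :=
  TwoFlagOrbits α ∧
    ∀ (Φ Ψ : Flag α) (i : ℕ), i < n → IsIAdjacent rk i Φ Ψ →
      (SameFlagOrbit Φ Ψ ↔ i ∈ I)

/-- An abstract polytope of rank `d`: a bounded poset, graded by a rank function `rk`
taking values `-1, 0, …, d`, in which every flag (maximal chain) has exactly one element
of each rank, satisfying the diamond condition and strong flag-connectivity. -/
structure IsAbstractPolytope (α : Type*) [PartialOrder α] [BoundedOrder α]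
    (rk : α → ℤ) (d : ℕ) : Prop where
  rk_bot : rk ⊥ = -1
  rk_top : rk ⊤ = d
  rk_strictMono : StrictMono rk
  rk_cover : ∀ x y : α, x ⋖ y → rk y = rk x + 1
  flag_ranks : ∀ (Φ : Flag α) (i : ℤ), -1 ≤ i → i ≤ d → ∃! x, x ∈ Φ ∧ rk x = i
  diamond : ∀ x y : α, x < y → rk y = rk x + 2 →
    ∃ a b : α, a ≠ b ∧ ∀ z : α, (x < z ∧ z < y) ↔ (z = a ∨ z = b)
  connected : ∀ Φ Ψ : Flag α, ∃ (n : ℕ) (c : Fin (n + 1) → Flag α),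
    c 0 = Φ ∧ c (Fin.last n) = Ψ ∧
    (∀ k : Fin n, ∃ i : ℤ, IsIAdjacent rk i (c k.castSucc) (c k.succ)) ∧
    (∀ k, (Φ : Set α) ∩ (Ψ : Set α) ⊆ (c k : Set α))
/-! Definitions about convex polytopes and their face lattices. -/

/-- Euclidean `d`-space. -/
abbrev EucSp (d : ℕ) : Type := EuclideanSpace ℝ (Fin d)

/-- A convex `d`-polytope: the convex hull of a finite set of points of `ℝ^d`,
with nonempty interior. -/
def IsConvexPolytope {d : ℕ} (P : Set (EucSp d)) : Prop :=
  (∃ S : Finset (EucSp d), P = convexHull ℝ (S : Set (EucSp d))) ∧ (interior P).Nonempty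

/-- The face lattice of `P`: the exposed faces of `P` (intersections of `P` with supporting
hyperplanes, together with `∅` and `P` itself), ordered by inclusion. -/
def Faces {d : ℕ} (P : Set (EucSp d)) : Type := {F : Set (EucSp d) // IsExposed ℝ P F}

noncomputable instance {d : ℕ} (P : Set (EucSp d)) : PartialOrder (Faces P) :=
  Subtype.partialOrder _

open scoped Classical

/-- The rank of a face: `-1` for the empty face, and otherwise its affine dimension. -/
noncomputable def faceRank {d : ℕ} {P : Set (EucSp d)} (F : Faces P) : ℤ :=
  if F.1 = ∅ then -1
  else (Module.finrank ℝ (affineSpan ℝ F.1).direction : ℤ)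

set_option linter.unusedSectionVars false
set_option linter.unusedVariables false

/-- A finite vector configuration whose poset of faces is `α`. -/
structure PolyModel (α : Type*) [PartialOrder α] {ι V : Type*} [AddCommGroup V] [Module ℝ V]
    (s : ι → V) (n : ℕ) where
  T : α → Set ι
  le_iff : ∀ a b, a ≤ b ↔ T a ⊆ T b
  m : α → V →ₗ[ℝ] ℝ
  m_nonneg : ∀ a i, 0 ≤ m a (s i)
  m_zero : ∀ a i, m a (s i) = 0 ↔ i ∈ T a
  surj : ∀ f : V →ₗ[ℝ] ℝ, (∀ i, 0 ≤ f (s i)) → ∃ a, ∀ i, i ∈ T a ↔ f (s i) = 0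
  hbot : ∃ f : V →ₗ[ℝ] ℝ, ∀ i, 0 < f (s i)
  htop : Module.finrank ℝ (Submodule.span ℝ (Set.range s)) = n

namespace PolyModel

variable {ι V : Type*} [Finite ι] [AddCommGroup V] [Module ℝ V] [FiniteDimensional ℝ V]
  {s : ι → V} {n : ℕ} (M : PolyModel α s n)

/-- The linear span of a face. -/
def sp (a : α) : Submodule ℝ V := Submodule.span ℝ (s '' M.T a)

/-- The dimension of the cone over a face. -/
noncomputable def rho (a : α) : ℕ := Module.finrank ℝ (M.sp a)

theorem m_pos {a : α} {i : ι} (h : i ∉ M.T a) : 0 < M.m a (s i) :=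
  lt_of_le_of_ne (M.m_nonneg a i) (fun h' => h ((M.m_zero a i).1 h'.symm))

theorem lt_iff (a b : α) : a < b ↔ M.T a ⊂ M.T b := by
  rw [lt_iff_le_not_ge, M.le_iff, M.le_iff]; rfl

theorem T_inj {a b : α} (h : M.T a = M.T b) : a = b :=
  le_antisymm ((M.le_iff _ _).2 h.le) ((M.le_iff _ _).2 h.ge)

theorem exists_mem {a b : α} (h : a < b) : ∃ x, x ∈ M.T b ∧ x ∉ M.T a :=
  Set.exists_of_ssubset ((M.lt_iff a b).1 h)

theorem sp_zero {a : α} {f : V →ₗ[ℝ] ℝ} (h : ∀ i ∈ M.T a, f (s i) = 0) :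
    M.sp a ≤ LinearMap.ker f := by
  rw [sp, Submodule.span_le]
  rintro _ ⟨i, hi, rfl⟩
  exact h i hi

theorem mem_of_sp {a : α} {i : ι} (h : s i ∈ M.sp a) : i ∈ M.T a :=
  (M.m_zero a i).1 (M.sp_zero (fun j hj => (M.m_zero a j).2 hj) h)

theorem mem_sp {a : α} {i : ι} (h : i ∈ M.T a) : s i ∈ M.sp a :=
  Submodule.subset_span ⟨i, h, rfl⟩

theorem sp_mono {a b : α} (h : a ≤ b) : M.sp a ≤ M.sp b :=
  Submodule.span_mono (Set.image_mono ((M.le_iff _ _).1 h))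

theorem rho_lt {a b : α} (h : a < b) : M.rho a < M.rho b := by
  apply Submodule.finrank_lt_finrank_of_lt
  refine lt_of_le_of_ne (M.sp_mono h.le) fun he => ?_
  obtain ⟨x, hx, hx'⟩ := M.exists_mem h
  exact hx' (M.mem_of_sp (he ▸ M.mem_sp hx))

theorem vanish {a b : α} (hab : a < b) (hr : M.rho b = M.rho a + 1) {x : ι} (hx : x ∈ M.T b)
    (hx' : x ∉ M.T a) {f : V →ₗ[ℝ] ℝ} (h0 : ∀ i ∈ M.T a, f (s i) = 0) (h1 : f (s x) = 0) :
    ∀ i ∈ M.T b, f (s i) = 0 := by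
  have h2 : M.sp a ⊔ Submodule.span ℝ {s x} = M.sp b := by
    apply Submodule.eq_of_le_of_finrank_le
    · refine sup_le (M.sp_mono hab.le) ?_
      rw [Submodule.span_singleton_le_iff_mem]
      exact M.mem_sp hx
    · have : M.rho a < Module.finrank ℝ (M.sp a ⊔ Submodule.span ℝ {s x} : Submodule ℝ V) := by
        apply Submodule.finrank_lt_finrank_of_lt
        refine lt_of_le_of_ne le_sup_left fun he => hx' (M.mem_of_sp ?_)
        rw [he]
        exact Submodule.mem_sup_right (Submodule.mem_span_singleton_self _)
      change M.rho b ≤ _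
      omega
  have h3 : M.sp b ≤ LinearMap.ker f := by
    rw [← h2]
    refine sup_le (M.sp_zero h0) ?_
    rw [Submodule.span_singleton_le_iff_mem]
    exact h1
  exact fun i hi => h3 (M.mem_sp hi)

/-- A functional that is nonnegative on a face `b` cuts out a face of `b`. -/
theorem face_of_face (b : α) (f : V →ₗ[ℝ] ℝ) (hf : ∀ i ∈ M.T b, 0 ≤ f (s i)) :
    ∃ e, e ≤ b ∧ ∀ i, i ∈ M.T e ↔ i ∈ M.T b ∧ f (s i) = 0 := by
  have : ∃ K : ℝ, 0 ≤ K ∧ ∀ i, i ∉ M.T b → 0 < f (s i) + K * M.m b (s i) := by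
    obtain ⟨K, hK⟩ := (Set.finite_range (fun i => (1 - f (s i)) / M.m b (s i))).bddAbove
    refine ⟨max K 0, le_max_right _ _, fun i hi => ?_⟩
    have h1 : (1 - f (s i)) / M.m b (s i) ≤ max K 0 := le_max_of_le_left (hK ⟨i, rfl⟩)
    rw [div_le_iff₀ (M.m_pos hi)] at h1
    linarith
  obtain ⟨K, hK0, hK⟩ := this
  have h2 : ∀ i ∈ M.T b, (f + K • M.m b) (s i) = f (s i) := fun i hi => by
    simp [(M.m_zero b i).2 hi]
  have h3 : ∀ i ∉ M.T b, 0 < (f + K • M.m b) (s i) := fun i hi => by simpa using hK i hi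
  obtain ⟨e, he⟩ := M.surj (f + K • M.m b) (fun i => by
    by_cases hi : i ∈ M.T b
    · rw [h2 i hi]; exact hf i hi
    · exact (h3 i hi).le)
  have h4 : ∀ i, i ∈ M.T e ↔ i ∈ M.T b ∧ f (s i) = 0 := fun i => by
    rw [he]
    by_cases hi : i ∈ M.T b
    · rw [h2 i hi]; simp [hi]
    · simp only [hi, false_and, iff_false]
      exact (h3 i hi).ne'
  exact ⟨e, (M.le_iff _ _).2 fun i hi => ((h4 i).1 hi).1, h4⟩

/-- The face of `b` minimizing `l / m a`. -/
theorem argmin {a b : α} (hab : a < b) (l : V →ₗ[ℝ] ℝ) (hl : ∀ i ∈ M.T a, l (s i) = 0) :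
    ∃ (c : ℝ) (e : α), a < e ∧ e ≤ b ∧ (∀ x ∈ M.T b, c * M.m a (s x) ≤ l (s x)) ∧
      ∀ x, x ∈ M.T e ↔ x ∈ M.T b ∧ l (s x) = c * M.m a (s x) := by
  obtain ⟨x0, hx0, hmin⟩ := Set.exists_min_image (M.T b \ M.T a) (fun i => l (s i) / M.m a (s i))
    (Set.toFinite _) (M.exists_mem hab)
  set c := l (s x0) / M.m a (s x0) with hc
  have h1 : ∀ x ∈ M.T b, c * M.m a (s x) ≤ l (s x) := fun x hx => by
    by_cases hxa : x ∈ M.T a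
    · rw [hl x hxa, (M.m_zero a x).2 hxa]; simp
    · have := hmin x ⟨hx, hxa⟩
      rwa [le_div_iff₀ (M.m_pos hxa)] at this
  obtain ⟨e, he, he'⟩ := M.face_of_face b (l - c • M.m a) (fun i hi => by simpa using h1 i hi)
  have he2 : ∀ x, x ∈ M.T e ↔ x ∈ M.T b ∧ l (s x) = c * M.m a (s x) := fun x => by
    rw [he']; simp [sub_eq_zero]
  refine ⟨c, e, ?_, he, h1, he2⟩
  rw [M.lt_iff]
  refine ⟨fun x hx => ?_, fun h => hx0.2 (h ?_)⟩
  · rw [he2, hl x hx, (M.m_zero a x).2 hx]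
    exact ⟨(M.le_iff _ _).1 hab.le hx, by simp⟩
  · rw [he2]
    exact ⟨hx0.1, by rw [hc, div_mul_cancel₀ _ (M.m_pos hx0.2).ne']⟩

theorem exists_between {a b : α} (hab : a < b) (hr : M.rho a + 2 ≤ M.rho b) :
    ∃ e, a < e ∧ e < b := by
  obtain ⟨x, hx, hx'⟩ := M.exists_mem hab
  have : ∃ y ∈ M.T b, s y ∉ M.sp a ⊔ Submodule.span ℝ {s x} := by
    by_contra! hc
    have h1 : M.sp b ≤ M.sp a ⊔ Submodule.span ℝ {s x} := by
      rw [sp, Submodule.span_le]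
      rintro _ ⟨i, hi, rfl⟩
      exact hc i hi
    have h2 := Submodule.finrank_mono h1
    have h3 := Submodule.finrank_add_le_finrank_add_finrank (M.sp a) (Submodule.span ℝ {s x})
    have h4 : Module.finrank ℝ (Submodule.span ℝ {s x}) ≤ 1 := by
      simpa using finrank_span_le_card (R := ℝ) ({s x} : Set V)
    simp only [rho] at hr
    omega
  obtain ⟨y, hy, hy'⟩ := this
  obtain ⟨l, hly, hl⟩ := Submodule.exists_le_ker_of_notMem hy'
  have hla : ∀ i ∈ M.T a, l (s i) = 0 := fun i hi => hl (Submodule.mem_sup_left (M.mem_sp hi))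
  have hlx : l (s x) = 0 := hl (Submodule.mem_sup_right (Submodule.mem_span_singleton_self _))
  obtain ⟨c, e, h1, h2, h3, h4⟩ := M.argmin hab l hla
  refine ⟨e, h1, lt_of_le_of_ne h2 ?_⟩
  rintro rfl
  have h5 := ((h4 x).1 hx).2
  rw [hlx] at h5
  have h6 : c = 0 := by
    rcases mul_eq_zero.1 h5.symm with h | h
    · exact h
    · exact absurd h (M.m_pos hx').ne'
  have h7 := ((h4 y).1 hy).2
  rw [h6, zero_mul] at h7
  exact hly h7

/-- The other face in a diamond. -/
theorem diamond {a b z : α} (hr : M.rho b = M.rho a + 2) (h1 : a < z) (h2 : z < b) :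
    ∃ z', z' ≠ z ∧ a < z' ∧ z' < b ∧ ∀ e, a < e → e < b → e = z ∨ e = z' := by
  have hab := h1.trans h2
  have hmid : ∀ e, a < e → e < b → M.rho e = M.rho a + 1 := fun e he he' => by
    have := M.rho_lt he; have := M.rho_lt he'; omega
  have hza : ∀ i ∈ M.T a, M.m z (s i) = 0 := fun i hi =>
    (M.m_zero z i).2 ((M.le_iff _ _).1 h1.le hi)
  obtain ⟨c, z', h3, h4, h5, h6⟩ := M.argmin hab (-M.m z) (fun i hi => by simp [hza i hi])
  obtain ⟨y, hy, hya⟩ := M.exists_mem h1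
  have hyb : y ∈ M.T b := (M.le_iff _ _).1 h2.le hy
  obtain ⟨w, hw, hwa⟩ := M.exists_mem h3
  have hwb : w ∈ M.T b := (M.le_iff _ _).1 h4 hw
  obtain ⟨v, hv, hvz⟩ := M.exists_mem h2
  have hc : c < 0 := by
    have e1 := h5 v hv
    have e2 := M.m_pos hvz
    have e3 := M.m_nonneg a v
    simp only [LinearMap.neg_apply] at e1
    by_contra! hc
    nlinarith [mul_nonneg hc e3]
  have hwz : w ∉ M.T z := fun hwz => by
    have e1 := ((h6 w).1 hw).2
    rw [LinearMap.neg_apply, (M.m_zero z w).2 hwz, neg_zero] at e1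
    have := mul_neg_of_neg_of_pos hc (M.m_pos hwa)
    linarith
  have hyz' : y ∉ M.T z' := fun hyz' => by
    have e1 := ((h6 y).1 hyz').2
    rw [LinearMap.neg_apply, (M.m_zero z y).2 hy, neg_zero] at e1
    have := mul_neg_of_neg_of_pos hc (M.m_pos hya)
    linarith
  have h4' : z' < b := lt_of_le_of_ne h4 (fun h => hyz' (h ▸ hyb))
  refine ⟨z', fun h => hwz (h ▸ hw), h3, h4', fun e he he' => ?_⟩
  by_contra! hne
  have key : ∀ z, a < z → z < b → e ≠ z → ∀ y ∈ M.T z, y ∉ M.T a → y ∉ M.T e := by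
    intro z hz hz' hez y hy hya hye
    apply hez
    have k1 := M.vanish hz (hmid z hz hz') hy hya (f := M.m e)
      (fun i hi => (M.m_zero e i).2 ((M.le_iff _ _).1 he.le hi)) ((M.m_zero e y).2 hye)
    have k2 := M.vanish he (hmid e he he') hye hya (f := M.m z)
      (fun i hi => (M.m_zero z i).2 ((M.le_iff _ _).1 hz.le hi)) ((M.m_zero z y).2 hy)
    exact le_antisymm ((M.le_iff _ _).2 fun i hi => (M.m_zero z i).1 (k2 i hi))
      ((M.le_iff _ _).2 fun i hi => (M.m_zero e i).1 (k1 i hi))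
  have hye := key z h1 h2 hne.1 y hy hya
  have hwe := key z' h3 h4' hne.2 w hw hwa
  obtain ⟨x, hx, hxa⟩ := M.exists_mem he
  have hxz : x ∉ M.T z := fun h => key z h1 h2 hne.1 x h hxa hx
  have hxz' : x ∉ M.T z' := fun h => key z' h3 h4' hne.2 x h hxa hx
  set A := M.m e (s w) / M.m z (s w) with hA
  set B := M.m e (s y) / M.m z' (s y) with hB
  have hApos : 0 < A := div_pos (M.m_pos hwe) (M.m_pos hwz)
  have hBpos : 0 < B := div_pos (M.m_pos hye) (M.m_pos hyz')
  have hAe : A * M.m z (s w) = M.m e (s w) := div_mul_cancel₀ _ (M.m_pos hwz).ne'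
  have hBe : B * M.m z' (s y) = M.m e (s y) := div_mul_cancel₀ _ (M.m_pos hyz').ne'
  have g1 : ∀ i ∈ M.T z, (M.m e - A • M.m z - B • M.m z') (s i) = 0 := by
    refine M.vanish h1 (hmid z h1 h2) hy hya (fun i hi => ?_) ?_
    · simp [hza i hi, (M.m_zero e i).2 ((M.le_iff _ _).1 he.le hi),
        (M.m_zero z' i).2 ((M.le_iff _ _).1 h3.le hi)]
    · simp [(M.m_zero z y).2 hy, hBe]
  have g2 := M.vanish h2 (by rw [hmid z h1 h2, hr]) hwb hwz g1
    (by simp [(M.m_zero z' w).2 hw, hAe]) x ((M.le_iff _ _).1 he'.le hx)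
  simp only [LinearMap.sub_apply, LinearMap.smul_apply, smul_eq_mul, (M.m_zero e x).2 hx] at g2
  have := mul_pos hApos (M.m_pos hxz)
  have := mul_pos hBpos (M.m_pos hxz')
  linarith

/-- A functional negative on all proper faces strictly above `a` is negative on `b` minus `a`. -/
theorem all_neg {a b z : α} (h1 : a < z) (h2 : z < b)
    {l : V →ₗ[ℝ] ℝ} (hl : ∀ i ∈ M.T a, l (s i) = 0)
    (hneg : ∀ e, a < e → e < b → ∀ x ∈ M.T e, x ∉ M.T a → l (s x) < 0) :
    ∀ x ∈ M.T b, x ∉ M.T a → l (s x) < 0 := by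
  obtain ⟨c, e, h3, h4, h5, h6⟩ := M.argmin (h1.trans h2) (-l) (fun i hi => by simp [hl i hi])
  have hc : 0 < c := by
    have : ∃ x ∈ M.T e, x ∉ M.T a ∧ l (s x) < 0 := by
      rcases eq_or_lt_of_le h4 with rfl | h
      · obtain ⟨x, hx, hx'⟩ := M.exists_mem h1
        exact ⟨x, (M.le_iff _ _).1 h2.le hx, hx', hneg z h1 h2 x hx hx'⟩
      · obtain ⟨x, hx, hx'⟩ := M.exists_mem h3
        exact ⟨x, hx, hx', hneg e h3 h x hx hx'⟩
    obtain ⟨x, hx, hx', hlx⟩ := this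
    have e1 := ((h6 x).1 hx).2
    rw [LinearMap.neg_apply] at e1
    have e2 := M.m_pos hx'
    by_contra! hc
    nlinarith
  intro x hx hx'
  have e1 := h5 x hx
  rw [LinearMap.neg_apply] at e1
  have := mul_pos hc (M.m_pos hx')
  linarith

/-- The intersection of two faces is a face. -/
theorem inter (M : PolyModel α s n) (a b : α) : ∃ c, c ≤ a ∧ c ≤ b ∧ ∀ e, e ≤ a → e ≤ b → e ≤ c := by
  obtain ⟨c, hc⟩ := M.surj (M.m a + M.m b) (fun i => add_nonneg (M.m_nonneg a i) (M.m_nonneg b i))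
  have h : ∀ i, i ∈ M.T c ↔ i ∈ M.T a ∧ i ∈ M.T b := fun i => by
    rw [hc, ← M.m_zero, ← M.m_zero]
    exact add_eq_zero_iff_of_nonneg (M.m_nonneg a i) (M.m_nonneg b i)
  simp only [M.le_iff]
  exact ⟨c, fun i hi => ((h i).1 hi).1, fun i hi => ((h i).1 hi).2,
    fun e h1 h2 i hi => (h i).2 ⟨h1 hi, h2 hi⟩⟩

theorem exists_bot : ∃ a, M.T a = ∅ := by
  obtain ⟨f, hf⟩ := M.hbot
  obtain ⟨a, ha⟩ := M.surj f (fun i => (hf i).le)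
  exact ⟨a, Set.eq_empty_of_forall_notMem fun i hi => (hf i).ne' ((ha i).1 hi)⟩

theorem exists_top : ∃ a, M.T a = Set.univ := by
  obtain ⟨a, ha⟩ := M.surj 0 (fun i => by simp)
  exact ⟨a, Set.eq_univ_of_forall fun i => (ha i).2 (by simp)⟩

/-- The top face. -/
noncomputable def tp : α := M.exists_top.choose
/-- The bottom face. -/
noncomputable def bt : α := M.exists_bot.choose
theorem T_tp : M.T M.tp = Set.univ := M.exists_top.choose_spec
theorem T_bt : M.T M.bt = ∅ := M.exists_bot.choose_spec
theorem le_tp (a : α) : a ≤ M.tp := by rw [M.le_iff, T_tp]; exact Set.subset_univ _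
theorem bt_le (a : α) : M.bt ≤ a := by rw [M.le_iff, T_bt]; exact Set.empty_subset _
theorem rho_tp : M.rho M.tp = n := by
  rw [rho, sp, T_tp, Set.image_univ, M.htop]
theorem rho_bt : M.rho M.bt = 0 := by
  rw [rho, sp, T_bt]; simp
theorem rho_le (a : α) : M.rho a ≤ n := by
  have h := M.rho_tp
  have : M.rho a ≤ M.rho M.tp := Submodule.finrank_mono (M.sp_mono (M.le_tp a))
  omega

end PolyModel

namespace PolyModel

variable {ι V : Type*} [Finite ι] [AddCommGroup V] [Module ℝ V] [FiniteDimensional ℝ V]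
  {s : ι → V} {n : ℕ} (M : PolyModel α s n)

theorem eq_of_common {a z e : α} (hz : a < z) (he : a < e) (rz : M.rho z = M.rho a + 1)
    (re : M.rho e = M.rho a + 1) {y : ι} (hy : y ∈ M.T z) (hye : y ∈ M.T e) (hya : y ∉ M.T a) :
    e = z := by
  have k1 := M.vanish hz rz hy hya (f := M.m e)
    (fun i hi => (M.m_zero e i).2 ((M.le_iff _ _).1 he.le hi)) ((M.m_zero e y).2 hye)
  have k2 := M.vanish he re hye hya (f := M.m z)
    (fun i hi => (M.m_zero z i).2 ((M.le_iff _ _).1 hz.le hi)) ((M.m_zero z y).2 hy)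
  exact le_antisymm ((M.le_iff _ _).2 fun i hi => (M.m_zero z i).1 (k2 i hi))
    ((M.le_iff _ _).2 fun i hi => (M.m_zero e i).1 (k1 i hi))

/-- Complete flags, as functions (shifted by one: `F k` has rank `k - 1`). -/
structure CF where
  toFun : ℕ → α
  lt_succ' : ∀ k, k < n → toFun k < toFun (k + 1)
  eq_tp' : ∀ k, n ≤ k → toFun k = M.tp

instance : CoeFun M.CF (fun _ => ℕ → α) := ⟨CF.toFun⟩

variable {M}

namespace CF

@[ext] theorem ext {Φ Ψ : M.CF} (h : ∀ k, Φ k = Ψ k) : Φ = Ψ := by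
  cases Φ; cases Ψ
  congr
  exact funext h

theorem lt_succ (Φ : M.CF) {k : ℕ} (h : k < n) : Φ k < Φ (k + 1) := Φ.lt_succ' k h

theorem eq_tp (Φ : M.CF) {k : ℕ} (h : n ≤ k) : Φ k = M.tp := Φ.eq_tp' k h

theorem lt (Φ : M.CF) {j k : ℕ} (h : j < k) (hk : k ≤ n) : Φ j < Φ k := by
  induction k with
  | zero => omega
  | succ k ih =>
    rcases Nat.lt_succ_iff_lt_or_eq.1 h with h1 | rfl
    · exact (ih h1 (by omega)).trans (Φ.lt_succ (by omega))
    · exact Φ.lt_succ (by omega)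

theorem le (Φ : M.CF) {j k : ℕ} (h : j ≤ k) (hk : k ≤ n) : Φ j ≤ Φ k := by
  rcases eq_or_lt_of_le h with rfl | h
  · exact le_rfl
  · exact (Φ.lt h hk).le

theorem rho (Φ : M.CF) {k : ℕ} (h : k ≤ n) : M.rho (Φ k) = k := by
  have h1 : ∀ k, k ≤ n → k ≤ M.rho (Φ k) := by
    intro k
    induction k with
    | zero => intro _; omega
    | succ k ih =>
      intro hk
      have := ih (by omega)
      have := M.rho_lt (Φ.lt_succ (k := k) (by omega))
      omega
  have h2 : ∀ j, j ≤ n → M.rho (Φ (n - j)) ≤ n - j := by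
    intro j
    induction j with
    | zero => intro _; simpa using M.rho_le _
    | succ j ih =>
      intro hj
      have := ih (by omega)
      have h3 := M.rho_lt (Φ.lt_succ (k := n - (j + 1)) (by omega))
      rw [show n - (j + 1) + 1 = n - j by omega] at h3
      omega
  have h3 := h2 (n - k) (by omega)
  rw [show n - (n - k) = k by omega] at h3
  exact le_antisymm h3 (h1 k h)

theorem sub (Φ : M.CF) {j k : ℕ} (h : j ≤ k) (hk : k ≤ n) : M.T (Φ j) ⊆ M.T (Φ k) :=
  (M.le_iff _ _).1 (Φ.le h hk)

theorem zero (Φ : M.CF) : Φ 0 = M.bt := by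
  rcases eq_or_lt_of_le (M.bt_le (Φ 0)) with h | h
  · exact h.symm
  · have := M.rho_lt h
    rw [Φ.rho (Nat.zero_le _)] at this
    omega

theorem exists_other (Φ : M.CF) {i : ℕ} (h : 0 < i ∧ i < n) :
    ∃ z', z' ≠ Φ i ∧ Φ (i - 1) < z' ∧ z' < Φ (i + 1) ∧
      ∀ e, Φ (i - 1) < e → e < Φ (i + 1) → e = Φ i ∨ e = z' := by
  apply M.diamond
  · rw [Φ.rho (by omega), Φ.rho (by omega)]; omega
  · exact Φ.lt (by omega) (by omega)
  · exact Φ.lt (by omega) (by omega)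

/-- The adjacent flag. -/
noncomputable def sig (i : ℕ) (Φ : M.CF) : M.CF :=
  if h : 0 < i ∧ i < n then
    { toFun := Function.update Φ i (Φ.exists_other h).choose
      lt_succ' := fun k hk => by
        obtain ⟨-, h1, h2, -⟩ := (Φ.exists_other h).choose_spec
        by_cases hki : k = i
        · subst hki
          rw [Function.update_self, Function.update_of_ne (by omega)]
          exact h2
        · by_cases hki' : k + 1 = i
          · subst hki'
            rw [Function.update_self, Function.update_of_ne (by omega)]
            exact h1
          · rw [Function.update_of_ne hki, Function.update_of_ne hki']
            exact Φ.lt_succ hk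
      eq_tp' := fun k hk => by
        rw [Function.update_of_ne (by omega)]
        exact Φ.eq_tp hk }
  else Φ

theorem sig_of_ne (Φ : M.CF) {i k : ℕ} (h : k ≠ i) : sig i Φ k = Φ k := by
  unfold sig
  split_ifs
  · exact Function.update_of_ne h _ _
  · rfl

theorem sig_self_ne (Φ : M.CF) {i : ℕ} (h : 0 < i ∧ i < n) : sig i Φ i ≠ Φ i := by
  unfold sig
  rw [dif_pos h]
  change Function.update Φ.toFun i _ i ≠ _
  rw [Function.update_self]
  exact (Φ.exists_other h).choose_spec.1

theorem sig_ne (Φ : M.CF) {i : ℕ} (h : 0 < i ∧ i < n) : sig i Φ ≠ Φ :=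
  fun h' => sig_self_ne Φ h (by rw [h'])

/-- A flag agreeing with `Φ` off `i` is `Φ` or `sig i Φ`. -/
theorem eq_or_eq (Φ Ψ : M.CF) {i : ℕ} (h : 0 < i ∧ i < n) (hΨ : ∀ k, k ≠ i → Ψ k = Φ k) :
    Ψ = Φ ∨ Ψ = sig i Φ := by
  obtain ⟨z', h1, h2, h3, h4⟩ := Φ.exists_other h
  have key : ∀ Ω : M.CF, (∀ k, k ≠ i → Ω k = Φ k) → Ω i = Φ i ∨ Ω i = z' := by
    intro Ω hΩ
    apply h4
    · rw [← hΩ (i - 1) (by omega)]; exact Ω.lt (by omega) (by omega)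
    · rw [← hΩ (i + 1) (by omega)]; exact Ω.lt (by omega) (by omega)
  have hs : sig i Φ i = z' := (key (sig i Φ) (fun k hk => sig_of_ne Φ hk)).resolve_left
    (sig_self_ne Φ h)
  rcases key Ψ hΨ with h5 | h5
  · left
    ext k
    by_cases hk : k = i
    · rw [hk, h5]
    · exact hΨ k hk
  · right
    ext k
    by_cases hk : k = i
    · rw [hk, h5, hs]
    · rw [hΨ k hk, sig_of_ne Φ hk]

theorem sig_sig (i : ℕ) (Φ : M.CF) : sig i (sig i Φ) = Φ := by
  by_cases h : 0 < i ∧ i < n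
  · rcases eq_or_eq (sig i Φ) Φ h (fun k hk => (sig_of_ne Φ hk).symm) with h1 | h1
    · exact absurd h1.symm (sig_ne Φ h)
    · exact h1.symm
  · unfold sig
    simp [h]

theorem sig_comm {i j : ℕ} (h : i + 1 < j) (Φ : M.CF) : sig i (sig j Φ) = sig j (sig i Φ) := by
  by_cases hi : 0 < i ∧ i < n
  · by_cases hj : 0 < j ∧ j < n
    · have key : ∀ Ψ : M.CF, (∀ k, k ≠ i → k ≠ j → Ψ k = Φ k) → Ψ i ≠ Φ i → Ψ i = sig i Φ i := by
        intro Ψ hΨ hne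
        obtain ⟨z', h1, h2, h3, h4⟩ := Φ.exists_other hi
        have k1 : Ψ i = Φ i ∨ Ψ i = z' := by
          apply h4
          · rw [← hΨ (i - 1) (by omega) (by omega)]; exact Ψ.lt (by omega) (by omega)
          · rw [← hΨ (i + 1) (by omega) (by omega)]; exact Ψ.lt (by omega) (by omega)
        have k2 : sig i Φ i = Φ i ∨ sig i Φ i = z' := by
          apply h4
          · rw [← sig_of_ne Φ (i := i) (k := i - 1) (by omega)]
            exact (sig i Φ).lt (by omega) (by omega)
          · rw [← sig_of_ne Φ (i := i) (k := i + 1) (by omega)]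
            exact (sig i Φ).lt (by omega) (by omega)
        rw [k1.resolve_left hne, k2.resolve_left (sig_self_ne Φ hi)]
      have hA : sig i (sig j Φ) i = sig i Φ i := by
        apply key
        · intro k h1 h2; rw [sig_of_ne _ h1, sig_of_ne _ h2]
        · have := sig_self_ne (sig j Φ) hi
          rwa [sig_of_ne Φ (i := j) (k := i) (by omega)] at this
      rcases eq_or_eq (sig i Φ) (sig i (sig j Φ)) hj (fun k hk => by
        by_cases hki : k = i
        · rw [hki, hA]
        · rw [sig_of_ne _ hki, sig_of_ne _ hk, sig_of_ne _ hki]) with h1 | h1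
      · exfalso
        apply sig_self_ne Φ hj
        have := congrArg (fun Ω : M.CF => Ω j) h1
        rwa [sig_of_ne _ (show j ≠ i by omega), sig_of_ne _ (show j ≠ i by omega)] at this
      · exact h1
    · have : ∀ Ψ : M.CF, sig j Ψ = Ψ := fun Ψ => by unfold sig; rw [dif_neg hj]
      rw [this, this]
  · have : ∀ Ψ : M.CF, sig i Ψ = Ψ := fun Ψ => by unfold sig; rw [dif_neg hi]
    rw [this, this]

/-- Sections of rank two are polygons with at least three sides. -/
theorem not_digon (Φ : M.CF) {i : ℕ} (hi : 0 < i) (hin : i + 1 < n) :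
    sig (i + 1) (sig i Φ) ≠ sig i (sig (i + 1) Φ) := by
  intro h
  have e1 : sig (i + 1) (sig i Φ) i = sig i Φ i := sig_of_ne _ (by omega)
  have e2 : sig i (sig (i + 1) Φ) (i + 1) = sig (i + 1) Φ (i + 1) := sig_of_ne _ (by omega)
  -- both `Φ i` and `sig i Φ i` lie below `Φ (i+1)` and `sig (i+1) Φ (i+1)`
  have a1 : Φ i < Φ (i + 1) := Φ.lt (by omega) (by omega)
  have a2 : Φ i < sig (i + 1) Φ (i + 1) := by
    rw [← sig_of_ne Φ (i := i + 1) (k := i) (by omega)]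
    exact (sig (i + 1) Φ).lt (by omega) (by omega)
  have a3 : sig i Φ i < Φ (i + 1) := by
    rw [← sig_of_ne Φ (i := i) (k := i + 1) (by omega)]
    exact (sig i Φ).lt (by omega) (by omega)
  have a4 : sig i Φ i < sig (i + 1) Φ (i + 1) := by
    rw [← e2, ← e1, h]
    exact CF.lt _ (by omega) (by omega)
  obtain ⟨c, c1, c2, c3⟩ := M.inter (Φ (i + 1)) (sig (i + 1) Φ (i + 1))
  have b1 := c3 _ a1.le a2.le
  have b2 := c3 _ a3.le a4.le
  have r1 : M.rho (Φ i) = i := Φ.rho (by omega)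
  have r2 : M.rho (sig i Φ i) = i := CF.rho _ (by omega)
  have r3 : M.rho (Φ (i + 1)) = i + 1 := Φ.rho (by omega)
  have r4 : M.rho (sig (i + 1) Φ (i + 1)) = i + 1 := CF.rho _ (by omega)
  have hne := sig_self_ne Φ (i := i) (by omega)
  have hne' := sig_self_ne Φ (i := i + 1) (by omega)
  have hc : M.rho c < i + 1 := by
    rcases eq_or_lt_of_le c1 with h1 | h1
    · rcases eq_or_lt_of_le c2 with h2 | h2
      · exact absurd (h2.symm.trans h1) hne'
      · have := M.rho_lt h2; omega
    · have := M.rho_lt h1; omega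
  have d1 : Φ i = c := by
    rcases eq_or_lt_of_le b1 with h1 | h1
    · exact h1
    · have := M.rho_lt h1; omega
  have d2 : sig i Φ i = c := by
    rcases eq_or_lt_of_le b2 with h1 | h1
    · exact h1
    · have := M.rho_lt h1; omega
  exact hne (d2.trans d1.symm)

theorem finite_alpha (M : PolyModel α s n) : Finite α :=
  Finite.of_injective M.T fun _ _ h => M.T_inj h

instance : Finite M.CF := by
  have := finite_alpha M
  refine Finite.of_injective (fun (Φ : M.CF) (k : Fin n) => Φ k) fun Φ Ψ h => ?_
  ext k
  by_cases hk : k < n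
  · exact congrFun h ⟨k, hk⟩
  · rw [Φ.eq_tp (by omega), Ψ.eq_tp (by omega)]

end CF
end PolyModel

namespace PolyModel

variable {ι V : Type*} [Finite ι] [AddCommGroup V] [Module ℝ V] [FiniteDimensional ℝ V]
  {s : ι → V} {n : ℕ} (M : PolyModel α s n)

/-- The value of `l / m a` on `b` minus `a`. -/
noncomputable def slope (l : V →ₗ[ℝ] ℝ) (a b : α) : ℝ :=
  if h : ∃ x, x ∈ M.T b ∧ x ∉ M.T a then l (s h.choose) / M.m a (s h.choose) else 0

/-- The functionals attached to a flag. -/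
noncomputable def Lf (l : V →ₗ[ℝ] ℝ) (F : ℕ → α) : ℕ → (V →ₗ[ℝ] ℝ)
  | 0 => l
  | k + 1 => Lf l F k - M.slope (Lf l F k) (F k) (F (k + 1)) • M.m (F k)

/-- The heights attached to a flag. -/
noncomputable def ht (l : V →ₗ[ℝ] ℝ) (F : ℕ → α) (k : ℕ) : ℝ :=
  M.slope (M.Lf l F k) (F k) (F (k + 1))

theorem Lf_succ (l : V →ₗ[ℝ] ℝ) (F : ℕ → α) (k : ℕ) (v : V) :
    M.Lf l F (k + 1) v = M.Lf l F k v - M.ht l F k * M.m (F k) v := by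
  rw [Lf]; rfl

theorem Lf_congr (l : V →ₗ[ℝ] ℝ) {F G : ℕ → α} {k : ℕ} (h : ∀ j, j ≤ k → F j = G j) :
    M.Lf l F k = M.Lf l G k := by
  induction k with
  | zero => rfl
  | succ k ih => rw [Lf, Lf, ih fun j hj => h j (by omega), h k (by omega), h (k + 1) le_rfl]

theorem ht_congr (l : V →ₗ[ℝ] ℝ) {F G : ℕ → α} {k : ℕ} (h : ∀ j, j ≤ k + 1 → F j = G j) :
    M.ht l F k = M.ht l G k := by
  rw [ht, ht, M.Lf_congr l fun j hj => h j (by omega), h k (by omega), h (k + 1) le_rfl]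

variable {M}

theorem Lf_zero (l : V →ₗ[ℝ] ℝ) (Φ : M.CF) {k : ℕ} (hk : k ≤ n) :
    ∀ x ∈ M.T (Φ k), M.Lf l Φ k (s x) = 0 := by
  induction k with
  | zero =>
    intro x hx
    rw [Φ.zero, M.T_bt] at hx
    exact absurd hx (Set.notMem_empty x)
  | succ k ih =>
    have h : ∃ x, x ∈ M.T (Φ (k + 1)) ∧ x ∉ M.T (Φ k) := M.exists_mem (Φ.lt_succ (by omega))
    refine M.vanish (Φ.lt_succ (k := k) (by omega)) ?_ h.choose_spec.1 h.choose_spec.2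
      (fun i hi => ?_) ?_
    · rw [Φ.rho hk, Φ.rho (by omega)]
    · rw [Lf_succ, ih (by omega) i hi, (M.m_zero _ i).2 hi]; simp
    · rw [Lf_succ, ht, slope, dif_pos h, div_mul_cancel₀ _ (M.m_pos h.choose_spec.2).ne', sub_self]

theorem Lf_val (l : V →ₗ[ℝ] ℝ) (Φ : M.CF) {k : ℕ} (hk : k < n) {x : ι}
    (hx : x ∈ M.T (Φ (k + 1))) : M.Lf l Φ k (s x) = M.ht l Φ k * M.m (Φ k) (s x) := by
  have := Lf_zero l Φ (k := k + 1) hk x hx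
  rw [Lf_succ] at this
  linarith

/-- Generic functionals. -/
theorem exists_generic (M : PolyModel α s n) :
    ∃ l : V →ₗ[ℝ] ℝ, ∀ Φ : M.CF, ∀ k, k < n → M.ht l Φ k ≠ 0 := by
  have hu : ∀ p : M.CF × Fin n, ∃ u : V, u ≠ 0 ∧ u ∈ M.sp (p.1 (p.2 + 1)) ∧
      ∀ j, j < (p.2 : ℕ) → M.m (p.1 j) u = 0 := by
    rintro ⟨Φ, k⟩
    let g : M.sp (Φ (k + 1)) →ₗ[ℝ] (Fin k → ℝ) :=
      LinearMap.pi fun j => (M.m (Φ j)).comp (Submodule.subtype _)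
    have hg : LinearMap.ker g ≠ ⊥ := by
      apply LinearMap.ker_ne_bot_of_finrank_lt
      have : Module.finrank ℝ (M.sp (Φ (k + 1))) = k + 1 := Φ.rho (by omega)
      rw [this]; simp
    obtain ⟨u, hu, hu0⟩ := Submodule.exists_mem_ne_zero_of_ne_bot hg
    refine ⟨u, by simpa using hu0, u.2, fun j hj => ?_⟩
    have := congrFun (LinearMap.mem_ker.1 hu) ⟨j, hj⟩
    simpa [g] using this
  choose u hu0 hu1 hu2 using hu
  obtain ⟨l, hl⟩ := Module.exists_dual_forall_apply_ne_zero (K := ℝ) u hu0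
  refine ⟨l, fun Φ k hk h0 => hl (Φ, ⟨k, hk⟩) ?_⟩
  have h1 : ∀ j, j ≤ k → M.Lf l Φ j (u (Φ, ⟨k, hk⟩)) = l (u (Φ, ⟨k, hk⟩)) := by
    intro j
    induction j with
    | zero => intro _; rfl
    | succ j ih =>
      intro hj
      rw [Lf_succ, ih (by omega), hu2 (Φ, ⟨k, hk⟩) j (by simpa using hj)]; simp
  rw [← h1 k le_rfl]
  have h2 : M.sp (Φ (k + 1)) ≤ LinearMap.ker (M.Lf l Φ k) := by
    apply M.sp_zero
    intro i hi
    rw [Lf_val l Φ hk hi, h0, zero_mul]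
  exact h2 (hu1 (Φ, ⟨k, hk⟩))

theorem Lf_diff (l : V →ₗ[ℝ] ℝ) (Φ Ψ : M.CF) {i : ℕ} (hi : i < n) (h : ∀ j, j ≤ i → Φ j = Ψ j)
    {x : ι} (hx : x ∈ M.T (Ψ (i + 1))) :
    M.Lf l Φ (i + 1) (s x) = (M.ht l Ψ i - M.ht l Φ i) * M.m (Φ i) (s x) := by
  rw [Lf_succ, M.Lf_congr l h, Lf_val l Ψ hi hx, h i le_rfl]
  ring

/-- The order key of a flag. -/
noncomputable def key (l : V →ₗ[ℝ] ℝ) (Φ : M.CF) : Lex (ℕ → ℝ) := toLex (M.ht l Φ)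

theorem key_lt (l : V →ₗ[ℝ] ℝ) {Φ Ψ : M.CF} {i : ℕ} (h : ∀ j, j ≤ i → Φ j = Ψ j)
    (hlt : M.ht l Ψ i < M.ht l Φ i) : key l Ψ < key l Φ :=
  ⟨i, fun j hj => M.ht_congr l fun k hk => (h k (by omega)).symm, hlt⟩

theorem ht_sig (l : V →ₗ[ℝ] ℝ) (Φ : M.CF) {i : ℕ} (hi : i + 1 < n) :
    (M.ht l Φ (i + 1) < 0 → M.ht l (CF.sig (i + 1) Φ) i < M.ht l Φ i) ∧
    (0 < M.ht l Φ (i + 1) → M.ht l Φ i < M.ht l (CF.sig (i + 1) Φ) i) := by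
  set Ψ := CF.sig (i + 1) Φ with hΨ
  have hagree : ∀ j, j ≤ i → Φ j = Ψ j := fun j hj => (CF.sig_of_ne Φ (by omega)).symm
  have h2 : Ψ (i + 1 + 1) = Φ (i + 1 + 1) := CF.sig_of_ne Φ (by omega)
  obtain ⟨x, hx, hx'⟩ := M.exists_mem (Ψ.lt_succ (k := i) (by omega))
  rw [← hagree i le_rfl] at hx'
  have hxn : x ∉ M.T (Φ (i + 1)) := fun hxn => by
    apply CF.sig_self_ne Φ (i := i + 1) (by omega)
    refine M.eq_of_common (a := Φ i) (Φ.lt_succ (by omega)) ?_ ?_ ?_ hxn hx hx'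
    · rw [hagree i le_rfl]; exact Ψ.lt_succ (by omega)
    · rw [Φ.rho (by omega), Φ.rho (by omega)]
    · rw [Φ.rho (by omega), CF.rho _ (by omega)]
  have e1 := Lf_diff l Φ Ψ (by omega) hagree hx
  have e2 := Lf_val l Φ (k := i + 1) hi (x := x) (h2 ▸ Ψ.sub (by omega) (by omega) hx)
  have p1 := M.m_pos hx'
  have p2 := M.m_pos hxn
  rw [e2] at e1
  constructor
  · intro h
    have := mul_neg_of_neg_of_pos h p2
    rw [e1] at this
    have := (neg_iff_neg_of_mul_pos' p1 this)
    linarith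
  · intro h
    have := mul_pos h p2
    rw [e1] at this
    have := pos_of_mul_pos_left this p1.le
    linarith
where
  neg_iff_neg_of_mul_pos' {a b : ℝ} (hb : 0 < b) (h : a * b < 0) : a < 0 := by
    by_contra! hc
    nlinarith [mul_nonneg hc hb.le]

/-- Descents. -/
def desc (l : V →ₗ[ℝ] ℝ) (i : ℕ) (Φ : M.CF) : Prop := key l (CF.sig i Φ) < key l Φ

variable {l : V →ₗ[ℝ] ℝ}

theorem desc_iff (hl : ∀ Φ : M.CF, ∀ k, k < n → M.ht l Φ k ≠ 0)
    (Φ : M.CF) {i : ℕ} (hi : 0 < i ∧ i < n) : desc l i Φ ↔ M.ht l Φ i < 0 := by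
  obtain ⟨i, rfl⟩ : ∃ j, i = j + 1 := ⟨i - 1, by omega⟩
  have h1 := ht_sig l Φ hi.2
  have hagree : ∀ j, j ≤ i → Φ j = CF.sig (i + 1) Φ j :=
    fun j hj => (CF.sig_of_ne Φ (by omega)).symm
  constructor
  · intro h
    by_contra hc
    have h2 : 0 < M.ht l Φ (i + 1) := lt_of_le_of_ne (not_lt.1 hc) (hl Φ _ hi.2).symm
    exact lt_asymm h (key_lt l (fun j hj => (hagree j hj).symm) (h1.2 h2))
  · exact fun h => key_lt l hagree (h1.1 h)

theorem desc_sig (hl : ∀ Φ : M.CF, ∀ k, k < n → M.ht l Φ k ≠ 0)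
    (Φ : M.CF) {i : ℕ} (hi : 0 < i ∧ i < n) :
    desc l i (CF.sig i Φ) ↔ ¬ desc l i Φ := by
  unfold desc
  rw [CF.sig_sig]
  constructor
  · exact fun h => lt_asymm h
  · intro h
    have h2 : ¬ M.ht l Φ i < 0 := fun h' => h ((desc_iff hl Φ hi).2 h')
    obtain ⟨i, rfl⟩ : ∃ j, i = j + 1 := ⟨i - 1, by omega⟩
    exact key_lt l (fun j hj => CF.sig_of_ne Φ (by omega))
      ((ht_sig l Φ hi.2).2 (lt_of_le_of_ne (not_lt.1 h2) (hl Φ _ hi.2).symm))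

theorem O2_aux (hl : ∀ Φ : M.CF, ∀ k, k < n → M.ht l Φ k ≠ 0)
    (Φ Ψ : M.CF) {i j : ℕ} (hi : 0 < i) (hij : i < j) (hj : j < n)
    (h1 : desc l i Φ) (h2 : desc l j Φ) (hag : ∀ k, k ≠ i → k ≠ j → Ψ k = Φ k) (hne : Ψ ≠ Φ) :
    key l Ψ < key l Φ := by
  have d1 := (desc_iff hl Φ ⟨hi, by omega⟩).1 h1
  have d2 := (desc_iff hl Φ ⟨by omega, hj⟩).1 h2
  by_cases he : Ψ i = Φ i
  · rcases CF.eq_or_eq Φ Ψ (i := j) ⟨by omega, hj⟩ (fun k hk => by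
      by_cases hki : k = i
      · rw [hki, he]
      · exact hag k hki hk) with h | h
    · exact absurd h hne
    · rw [h]; exact h2
  · obtain ⟨i, rfl⟩ : ∃ j, i = j + 1 := ⟨i - 1, by omega⟩
    have hagree : ∀ k, k ≤ i → Φ k = Ψ k := fun k hk => (hag k (by omega) (by omega)).symm
    refine key_lt l hagree ?_
    obtain ⟨x, hx, hx'⟩ := M.exists_mem (Ψ.lt_succ (k := i) (by omega))
    rw [← hagree i le_rfl] at hx'
    have hxn : x ∉ M.T (Φ (i + 1)) := fun hxn => by
      apply he
      refine M.eq_of_common (a := Φ i) (Φ.lt_succ (by omega)) ?_ ?_ ?_ hxn hx hx'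
      · rw [hagree i le_rfl]; exact Ψ.lt_succ (by omega)
      · rw [Φ.rho (by omega), Φ.rho (by omega)]
      · rw [Φ.rho (by omega), CF.rho _ (by omega)]
    have e1 := Lf_diff l Φ Ψ (by omega) hagree hx
    have p1 := M.m_pos hx'
    have hneg : M.Lf l Φ (i + 1) (s x) < 0 := by
      by_cases hj' : j = i + 2
      · subst hj'
        have hx2 : x ∈ M.T (Φ (i + 3)) := by
          rw [← hag (i + 3) (by omega) (by omega)]
          exact Ψ.sub (by omega) (by omega) hx
        refine M.all_neg (a := Φ (i + 1)) (z := Φ (i + 2)) (b := Φ (i + 3))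
          (Φ.lt (by omega) (by omega)) (Φ.lt (by omega) (by omega))
          (Lf_zero l Φ (by omega)) ?_ x hx2 hxn
        have hz : ∀ y ∈ M.T (Φ (i + 2)), y ∉ M.T (Φ (i + 1)) → M.Lf l Φ (i + 1) (s y) < 0 := by
          intro y hy hy'
          rw [Lf_val l Φ (by omega) hy]
          exact mul_neg_of_neg_of_pos d1 (M.m_pos hy')
        intro e he1 he2 y hy hy'
        obtain ⟨z', k1, k2, k3, k4⟩ := Φ.exists_other (i := i + 2) (by omega)
        set Ω := CF.sig (i + 2) Φ with hΩ
        have g1 : ∀ k, k ≤ i + 1 → Φ k = Ω k := fun k hk => (CF.sig_of_ne Φ (by omega)).symm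
        have hΩz : Ω (i + 2) = z' := by
          refine (k4 (Ω (i + 2)) ?_ ?_).resolve_left (CF.sig_self_ne Φ (by omega))
          · rw [g1 (i + 2 - 1) (by omega)]; exact Ω.lt (by omega) (by omega)
          · rw [← CF.sig_of_ne Φ (i := i + 2) (k := i + 2 + 1) (by omega)]
            exact Ω.lt (by omega) (by omega)
        rcases k4 e he1 he2 with rfl | rfl
        · exact hz y hy hy'
        · have q1 := (ht_sig l Φ (i := i + 1) (by omega)).1 d2
          rw [M.Lf_congr l g1, Lf_val l Ω (by omega) (by rw [hΩz]; exact hy),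
            ← g1 (i + 1) le_rfl]
          exact mul_neg_of_neg_of_pos (q1.trans d1) (M.m_pos hy')
      · have hx2 : x ∈ M.T (Φ (i + 1 + 1)) := by
          rw [← hag (i + 1 + 1) (by omega) (by omega)]
          exact Ψ.sub (by omega) (by omega) hx
        rw [Lf_val l Φ (by omega) hx2]
        exact mul_neg_of_neg_of_pos d1 (M.m_pos hxn)
    rw [e1] at hneg
    by_contra! hc
    nlinarith [mul_nonneg (sub_nonneg.2 hc) p1.le]

/-- A flag with descents `i` and `j` is the strict maximum of its `{i, j}`-residue. -/
theorem O2 (hl : ∀ Φ : M.CF, ∀ k, k < n → M.ht l Φ k ≠ 0)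
    (Φ Ψ : M.CF) {i j : ℕ} (hi : 0 < i ∧ i < n) (hj : 0 < j ∧ j < n) (hij : i ≠ j)
    (h1 : desc l i Φ) (h2 : desc l j Φ) (hag : ∀ k, k ≠ i → k ≠ j → Ψ k = Φ k) (hne : Ψ ≠ Φ) :
    key l Ψ < key l Φ := by
  rcases lt_or_gt_of_ne hij with h | h
  · exact O2_aux hl Φ Ψ hi.1 h hj.2 h1 h2 hag hne
  · exact O2_aux hl Φ Ψ hj.1 h hi.2 h2 h1 (fun k a b => hag k b a) hne

theorem O1_aux (Φ : M.CF) {a b : ℕ} (hb : b ≤ n) (hpos : ∀ k, a < k → k < b → 0 < M.ht l Φ k) :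
    ∀ j, a < b - j → j ≤ b → ∀ x ∈ M.T (Φ b), 0 ≤ M.Lf l Φ (b - j) (s x) ∧
      (M.Lf l Φ (b - j) (s x) = 0 → x ∈ M.T (Φ (b - j))) := by
  intro j
  induction j with
  | zero =>
    intro _ _ x hx
    exact ⟨(Lf_zero l Φ hb x hx).ge, fun _ => hx⟩
  | succ j ih =>
    intro h1 h2 x hx
    obtain ⟨h3, h4⟩ := ih (by omega) (by omega) x hx
    obtain ⟨k, hk⟩ : ∃ k, k = b - (j + 1) := ⟨_, rfl⟩
    rw [show b - j = k + 1 by omega] at h3 h4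
    rw [← hk]
    have hp := hpos k (by omega) (by omega)
    rw [Lf_succ] at h3 h4
    have hm := M.m_nonneg (Φ k) x
    have := mul_nonneg hp.le hm
    refine ⟨by linarith, fun h0 => ?_⟩
    rw [← M.m_zero]
    rw [h0] at h3
    have : M.ht l Φ k * M.m (Φ k) (s x) = 0 := by linarith
    rcases mul_eq_zero.1 this with h | h
    · exact absurd h hp.ne'
    · exact h

theorem O1_step (Φ Ψ : M.CF) {a b : ℕ} (hb : b ≤ n) (hab : Φ b = Ψ b)
    (hΨ : ∀ k, a < k → k < b → 0 < M.ht l Ψ k) {k : ℕ} (hak : a ≤ k) (hkb : k < b)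
    (hag : ∀ j, j ≤ k → Φ j = Ψ j) : M.ht l Ψ k ≤ M.ht l Φ k := by
  obtain ⟨x, hx, hx'⟩ := M.exists_mem (Φ.lt_succ (k := k) (by omega))
  have hxb : x ∈ M.T (Ψ b) := hab ▸ Φ.sub (by omega) hb hx
  have h1 := (O1_aux Ψ hb hΨ (b - (k + 1)) (by omega) (by omega) x hxb).1
  rw [show b - (b - (k + 1)) = k + 1 by omega,
    Lf_diff l Ψ Φ (by omega) (fun j hj => (hag j hj).symm) hx] at h1
  have p := M.m_pos hx'
  rw [hag k le_rfl] at p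
  by_contra! hc
  nlinarith [mul_pos (sub_pos.2 hc) p]

/-- Uniqueness of the flag without descents in an interval. -/
theorem O1 (Φ Ψ : M.CF) {a b : ℕ} (hb : b ≤ n) (haab : a < b) (hag : ∀ j, j ≤ a → Φ j = Ψ j)
    (hab : Φ b = Ψ b) (hΦ : ∀ k, a < k → k < b → 0 < M.ht l Φ k)
    (hΨ : ∀ k, a < k → k < b → 0 < M.ht l Ψ k) : ∀ j, j ≤ b → Φ j = Ψ j := by
  have key : ∀ k, a ≤ k → k ≤ b → ∀ j, j ≤ k → Φ j = Ψ j := by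
    intro k hk
    induction k, hk using Nat.le_induction with
    | base => intro _; exact hag
    | succ k hak ih =>
      intro hkb
      have ih := ih (by omega)
      have h1 := O1_step Φ Ψ hb hab hΨ hak (by omega) ih
      have h2 := O1_step Ψ Φ hb hab.symm hΦ hak (by omega) (fun j hj => (ih j hj).symm)
      have h3 : M.Lf l Φ (k + 1) = M.Lf l Ψ (k + 1) := by
        apply LinearMap.ext
        intro v
        rw [Lf_succ, Lf_succ, M.Lf_congr l ih, le_antisymm h1 h2, ih k le_rfl]
      have key2 : ∀ Φ Ψ : M.CF, Φ b = Ψ b → M.Lf l Φ (k + 1) = M.Lf l Ψ (k + 1) →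
          (∀ k, a < k → k < b → 0 < M.ht l Ψ k) → M.T (Φ (k + 1)) ⊆ M.T (Ψ (k + 1)) := by
        intro Φ Ψ hab h3 hΨ x hx
        have hxb : x ∈ M.T (Ψ b) := hab ▸ Φ.sub (by omega) hb hx
        have h1 := (O1_aux Ψ hb hΨ (b - (k + 1)) (by omega) (by omega) x hxb).2
        rw [show b - (b - (k + 1)) = k + 1 by omega] at h1
        apply h1
        rw [← h3]
        exact Lf_zero l Φ (by omega) x hx
      intro j hj
      rcases Nat.lt_or_ge j (k + 1) with h | h
      · exact ih j (by omega)
      · obtain rfl : j = k + 1 := by omega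
        exact M.T_inj (subset_antisymm (key2 Φ Ψ hab h3 hΨ) (key2 Ψ Φ hab.symm h3.symm hΦ))
  exact key b haab.le le_rfl

end PolyModel

namespace PolyModel

variable {ι V : Type*} [Finite ι] [AddCommGroup V] [Module ℝ V] [FiniteDimensional ℝ V]
  {s : ι → V} {n : ℕ} {M : PolyModel α s n}

namespace CF

/-- The basic rotation of a rank two residue. -/
noncomputable def rr (i j : ℕ) (Φ : M.CF) : M.CF := sig j (sig i Φ)

theorem sig_iter (i j k : ℕ) (Φ : M.CF) :
    sig i ((rr i j)^[k] Φ) = (rr j i)^[k] (sig i Φ) := by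
  have h : Function.Semiconj (sig (M := M) i) (rr i j) (rr j i) := fun x => rfl
  exact (h.iterate_right k) Φ

theorem sig_iter_ne {i j : ℕ} (hi : 0 < i ∧ i < n) (hj : 0 < j ∧ j < n) (k : ℕ) (Φ : M.CF) :
    sig i ((rr i j)^[k] Φ) ≠ Φ := by
  induction k generalizing i j Φ with
  | zero => exact sig_ne Φ hi
  | succ k ih =>
    intro h
    apply ih hj hi (sig i Φ)
    rw [← sig_iter]
    have := congrArg (sig i) h
    rw [sig_sig, Function.iterate_succ_apply'] at this
    exact this

theorem rr_rr (i j : ℕ) (Φ : M.CF) : rr j i (rr i j Φ) = Φ := by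
  simp only [rr, sig_sig]

theorem rr_iter_inv (i j k : ℕ) (Φ : M.CF) : (rr j i)^[k] ((rr i j)^[k] Φ) = Φ :=
  Function.LeftInverse.iterate (rr_rr i j) k Φ

theorem rr_injective (i j : ℕ) : Function.Injective (rr (M := M) i j) :=
  Function.LeftInverse.injective (rr_rr i j)

theorem rr_iter_swap {i j k : ℕ} {Φ : M.CF} (h : (rr i j)^[k] Φ = Φ) : (rr j i)^[k] Φ = Φ := by
  have := rr_iter_inv i j k Φ
  rwa [h] at this

theorem rr_of_ne {i j m : ℕ} (h1 : m ≠ i) (h2 : m ≠ j) (Φ : M.CF) : rr i j Φ m = Φ m := by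
  rw [rr, sig_of_ne _ h2, sig_of_ne _ h1]

theorem rr_iter_of_ne {i j m : ℕ} (h1 : m ≠ i) (h2 : m ≠ j) (k : ℕ) (Φ : M.CF) :
    (rr i j)^[k] Φ m = Φ m := by
  induction k with
  | zero => rfl
  | succ k ih => rw [Function.iterate_succ_apply', rr_of_ne h1 h2, ih]

theorem rr_ne {i j : ℕ} (hi : 0 < i ∧ i < n) (hij : i ≠ j) (Φ : M.CF) :
    rr i j Φ ≠ Φ := by
  intro h
  have h1 : (sig j (sig i Φ)) i = Φ i := congrArg (fun Ω : M.CF => Ω i) h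
  rw [sig_of_ne _ hij] at h1
  exact sig_self_ne Φ hi h1

theorem sig_comm' {i j : ℕ} (h : i + 1 < j ∨ j + 1 < i) (Φ : M.CF) :
    sig i (sig j Φ) = sig j (sig i Φ) := by
  rcases h with h | h
  · exact sig_comm h Φ
  · exact (sig_comm h Φ).symm

theorem rr_two_ne {i : ℕ} (hi : 0 < i) (hin : i + 1 < n) (Φ : M.CF) :
    (rr i (i + 1))^[2] Φ ≠ Φ := by
  intro h
  have h' : sig (i + 1) (sig i (sig (i + 1) (sig i Φ))) = Φ := h
  have h2 := congrArg (sig (i + 1)) h'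
  rw [sig_sig] at h2
  have h3 := congrArg (sig i) h2
  rw [sig_sig] at h3
  exact not_digon Φ hi hin h3

end CF

open CF

theorem key_wf (l : V →ₗ[ℝ] ℝ) : WellFounded (fun Φ Ψ : M.CF => key l Φ < key l Ψ) :=
  haveI : IsTrans M.CF (fun Φ Ψ => key l Φ < key l Ψ) := ⟨fun _ _ _ => lt_trans⟩
  haveI : Std.Irrefl (fun Φ Ψ : M.CF => key l Φ < key l Ψ) := ⟨fun _ => lt_irrefl _⟩
  Finite.wellFounded_of_trans_of_irrefl _

/-- Residue connectivity. -/
theorem residue {C : M.CF → Prop} (k : ℕ)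
    (hC : ∀ i, i ≠ k → 0 < i ∧ i < n → ∀ Φ, C Φ → C (sig i Φ)) (Φ Ψ : M.CF)
    (h : Φ k = Ψ k) (hΦ : C Φ) : C Ψ := by
  obtain ⟨l, hl⟩ := exists_generic M
  have key : ∀ Φ : M.CF, ∃ Φ' : M.CF, Φ' k = Φ k ∧
      (∀ i, i ≠ k → 0 < i ∧ i < n → 0 < M.ht l Φ' i) ∧ (C Φ ↔ C Φ') := by
    intro Φ
    induction Φ using (key_wf l).induction with
    | h Φ ih =>
      by_cases hd : ∃ i, i ≠ k ∧ (0 < i ∧ i < n) ∧ desc l i Φ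
      · obtain ⟨i, hik, hi, hd⟩ := hd
        obtain ⟨Φ', a, b, c⟩ := ih (sig i Φ) hd
        refine ⟨Φ', ?_, b, ?_⟩
        · rw [a, sig_of_ne _ hik.symm]
        · rw [← c]
          refine ⟨hC i hik hi Φ, fun h => ?_⟩
          have := hC i hik hi _ h
          rwa [sig_sig] at this
      · push Not at hd
        refine ⟨Φ, rfl, fun i hik hi => ?_, Iff.rfl⟩
        have h1 := hd i hik hi
        rw [desc_iff hl Φ hi] at h1
        exact lt_of_le_of_ne (not_lt.1 h1) (hl Φ i hi.2).symm
  obtain ⟨Φ', a, b, c⟩ := key Φ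
  obtain ⟨Ψ', a', b', c'⟩ := key Ψ
  have hk : Φ' k = Ψ' k := by rw [a, a', h]
  have h0 : ∀ j, j ≤ 0 → Φ' j = Ψ' j := by
    intro j hj
    obtain rfl : j = 0 := by omega
    rw [CF.zero, CF.zero]
  have hn : Φ' n = Ψ' n := by rw [CF.eq_tp _ le_rfl, CF.eq_tp _ le_rfl]
  have heq : Φ' = Ψ' := by
    have hall : ∀ j, j ≤ n → Φ' j = Ψ' j := by
      rcases Nat.eq_zero_or_pos n with hn0 | hn0
      · intro j hj
        exact h0 j (by omega)
      · by_cases hkk : 0 < k ∧ k < n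
        · have s1 := O1 (l := l) Φ' Ψ' hkk.2.le hkk.1 h0 hk
            (fun i h1 h2 => b i (by omega) (by omega)) (fun i h1 h2 => b' i (by omega) (by omega))
          exact O1 (l := l) Φ' Ψ' le_rfl hkk.2 s1 hn
            (fun i h1 h2 => b i (by omega) (by omega)) (fun i h1 h2 => b' i (by omega) (by omega))
        · exact O1 (l := l) Φ' Ψ' le_rfl hn0 h0 hn
            (fun i h1 h2 => b i (by omega) (by omega)) (fun i h1 h2 => b' i (by omega) (by omega))
    ext j
    rcases le_total j n with hj | hj
    · exact hall j hj
    · rw [CF.eq_tp _ hj, CF.eq_tp _ hj]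
  rw [c', ← heq, ← c]
  exact hΦ

theorem connected {C : M.CF → Prop}
    (hC : ∀ i, 0 < i ∧ i < n → ∀ Φ, C Φ → C (sig i Φ)) (Φ Ψ : M.CF) (hΦ : C Φ) : C Ψ :=
  residue 0 (fun i _ hi => hC i hi) Φ Ψ (by rw [CF.zero, CF.zero]) hΦ

/-- Construction of the flag map. -/
theorem exists_sigma (hE : ∀ i j, 0 < i ∧ i < n → 0 < j ∧ j < n → i ≠ j →
      ∀ k, ∀ Φ Ψ : M.CF, (rr i j)^[k] Φ = Φ → (rr i j)^[k] Ψ = Ψ) (Φ₁ : M.CF) :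
    ∃ μ : M.CF, ∀ Ψ₀ : M.CF, ∃ σ : M.CF → M.CF, σ μ = Ψ₀ ∧
      ∀ i, 0 < i ∧ i < n → ∀ Φ, σ (sig i Φ) = sig i (σ Φ) := by
  obtain ⟨l, hl⟩ := exists_generic M
  have : Nonempty M.CF := ⟨Φ₁⟩
  obtain ⟨μ, -, hμ⟩ := (key_wf (M := M) l).has_min Set.univ Set.univ_nonempty
  refine ⟨μ, fun Ψ₀ => ?_⟩
  let Q : M.CF → ℕ → Prop := fun Φ i => (0 < i ∧ i < n) ∧ desc l i Φ
  let σ : M.CF → M.CF := (key_wf l).fix (fun Φ rec =>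
    if h : ∃ i, Q Φ i then sig h.choose (rec (sig h.choose Φ) h.choose_spec.2) else Ψ₀)
  have hσ : ∀ Φ, σ Φ = if h : ∃ i, Q Φ i then sig h.choose (σ (sig h.choose Φ)) else Ψ₀ :=
    fun Φ => (key_wf l).fix_eq _ Φ
  have main : ∀ Φ : M.CF, ∀ j, Q Φ j → σ Φ = sig j (σ (sig j Φ)) := by
    intro Φ
    induction Φ using (key_wf l).induction with
    | h Φ ih =>
      intro j hj
      have hex : ∃ i, Q Φ i := ⟨j, hj⟩
      rw [hσ, dif_pos hex]
      have hi : Q Φ hex.choose := hex.choose_spec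
      generalize hex.choose = i at hi
      by_cases hij : i = j
      · rw [hij]
      have step : ∀ Ω : M.CF, ∀ t, 0 < t ∧ t < n → key l Ω < key l Φ →
          key l (sig t Ω) < key l Φ → σ (sig t Ω) = sig t (σ Ω) := by
        intro Ω t ht h1 h2
        by_cases hd : desc l t Ω
        · rw [ih Ω h1 t ⟨ht, hd⟩, sig_sig]
        · rw [ih (sig t Ω) h2 t ⟨ht, (desc_sig hl Ω ht).2 hd⟩, sig_sig]
      have low : ∀ Ω : M.CF, (∀ m, m ≠ i → m ≠ j → Ω m = Φ m) → Ω ≠ Φ → key l Ω < key l Φ :=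
        fun Ω h1 h2 => O2 hl Φ Ω hi.1 hj.1 hij hi.2 hj.2 h1 h2
      set p := Function.minimalPeriod (rr i j) Φ with hp
      have hp0 : 0 < p := Function.minimalPeriod_pos_of_mem_periodicPts
        ((rr_injective (M := M) i j).mem_periodicPts Φ)
      have hpp : (rr i j)^[p] Φ = Φ := Function.iterate_minimalPeriod
      have hlt : ∀ k, 0 < k → k < p → (rr i j)^[k] Φ ≠ Φ := fun k h1 h2 =>
        Function.not_isPeriodicPt_of_pos_of_lt_minimalPeriod h1.ne' h2
      have low1 : ∀ k, 0 < k → k < p → key l ((rr i j)^[k] Φ) < key l Φ := fun k h1 h2 =>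
        low _ (fun m a b => rr_iter_of_ne a b k Φ) (hlt k h1 h2)
      have low2 : ∀ k, key l (sig i ((rr i j)^[k] Φ)) < key l Φ := fun k =>
        low _ (fun m a b => by rw [sig_of_ne _ a, rr_iter_of_ne a b k Φ])
          (sig_iter_ne hi.1 hj.1 k Φ)
      set Ψ' := sig i (σ (sig i Φ)) with hΨ'
      have ind : ∀ k, k < p → σ (sig i ((rr i j)^[k] Φ)) = sig i ((rr i j)^[k] Ψ') := by
        intro k
        induction k with
        | zero => intro _; simp [hΨ', sig_sig]
        | succ k ihk =>
          intro hk
          have e1 := ihk (by omega)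
          have e2 := step (sig i ((rr i j)^[k] Φ)) j hj.1 (low2 k) (by
            have := low1 (k + 1) (by omega) hk
            rwa [Function.iterate_succ_apply'] at this)
          have e3 := step ((rr i j)^[k + 1] Φ) i hi.1 (low1 (k + 1) (by omega) hk) (low2 (k + 1))
          rw [e3, Function.iterate_succ_apply', Function.iterate_succ_apply']
          have e4 : σ (rr i j ((rr i j)^[k] Φ)) = rr i j ((rr i j)^[k] Ψ') := by
            rw [rr, e2, e1, rr]
          rw [e4]
      have e1 := ind (p - 1) (by omega)
      have e2 : sig i ((rr i j)^[p - 1] Φ) = sig j Φ := by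
        have : (rr i j)^[p - 1 + 1] Φ = Φ := by rwa [show p - 1 + 1 = p by omega]
        rw [Function.iterate_succ_apply'] at this
        have := congrArg (sig j) this
        rwa [rr, sig_sig] at this
      rw [e2] at e1
      rw [e1]
      have : (rr i j)^[p - 1 + 1] Ψ' = Ψ' := by
        rw [show p - 1 + 1 = p by omega]
        exact hE i j hi.1 hj.1 hij p Φ Ψ' hpp
      rw [Function.iterate_succ_apply'] at this
      exact this.symm
  refine ⟨σ, ?_, fun i hi Φ => ?_⟩
  · rw [hσ, dif_neg]
    rintro ⟨i, hi, hd⟩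
    exact hμ _ (Set.mem_univ _) hd
  · by_cases hd : desc l i Φ
    · rw [main Φ i ⟨hi, hd⟩, sig_sig]
    · rw [main (sig i Φ) i ⟨hi, (desc_sig hl Φ hi).2 hd⟩, sig_sig]

end PolyModel

namespace PolyModel

variable {ι V : Type*} [Finite ι] [AddCommGroup V] [Module ℝ V] [FiniteDimensional ℝ V]
  {s : ι → V} {n : ℕ} {M : PolyModel α s n}

open CF

theorem flag_comp (f : Flag α) {x y : α} (hx : x ∈ f) (hy : y ∈ f) : x ≤ y ∨ y ≤ x :=
  Flag.mem_iff_forall_le_or_ge.1 hx hy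

theorem flag_lt (M : PolyModel α s n) (f : Flag α) {x y : α} (hx : x ∈ f) (hy : y ∈ f)
    (h : M.rho x < M.rho y) : x < y := by
  rcases flag_comp f hx hy with h1 | h1
  · rcases eq_or_lt_of_le h1 with rfl | h1
    · omega
    · exact h1
  · rcases eq_or_lt_of_le h1 with rfl | h1
    · omega
    · have := M.rho_lt h1
      omega

theorem flag_eq (M : PolyModel α s n) (f : Flag α) {x y : α} (hx : x ∈ f) (hy : y ∈ f)
    (h : M.rho x = M.rho y) : x = y := by
  rcases flag_comp f hx hy with h1 | h1
  · rcases eq_or_lt_of_le h1 with h1 | h1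
    · exact h1
    · have := M.rho_lt h1
      omega
  · rcases eq_or_lt_of_le h1 with h1 | h1
    · exact h1.symm
    · have := M.rho_lt h1
      omega

theorem flag_rank (M : PolyModel α s n) (f : Flag α) {k : ℕ} (hk : k ≤ n) :
    ∃ x ∈ f, M.rho x = k := by
  induction k with
  | zero => exact ⟨M.bt, Flag.mem_iff_forall_le_or_ge.2 fun b _ => Or.inl (M.bt_le b), M.rho_bt⟩
  | succ k ih =>
    obtain ⟨x, hx, hxk⟩ := ih (by omega)
    have htp : M.tp ∈ f := Flag.mem_iff_forall_le_or_ge.2 fun b _ => Or.inr (M.le_tp b)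
    have hex : ∃ m, ∃ y ∈ f, x < y ∧ M.rho y = m :=
      ⟨n, M.tp, htp, flag_lt M f hx htp (by rw [M.rho_tp]; omega), M.rho_tp⟩
    obtain ⟨y, hy, hxy, hym⟩ := Nat.find_spec hex
    have hmin : ∀ z ∈ f, x < z → M.rho y ≤ M.rho z := fun z hz hxz => by
      rw [hym]
      exact Nat.find_min' hex ⟨z, hz, hxz, rfl⟩
    by_cases h2 : M.rho x + 2 ≤ M.rho y
    · exfalso
      obtain ⟨e, he1, he2⟩ := M.exists_between hxy h2
      have hef : e ∈ f := Flag.mem_iff_forall_le_or_ge.2 fun z hz => by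
        rcases flag_comp f hx hz with h | h
        · rcases eq_or_lt_of_le h with rfl | h
          · exact Or.inr he1.le
          · rcases flag_comp f hy hz with h3 | h3
            · exact Or.inl (he2.le.trans h3)
            · rcases eq_or_lt_of_le h3 with rfl | h3
              · exact Or.inl he2.le
              · have := M.rho_lt h3
                have := hmin z hz h
                omega
        · exact Or.inr (h.trans he1.le)
      have := hmin e hef he1
      have := M.rho_lt he2
      omega
    · have := M.rho_lt hxy
      exact ⟨y, hy, by omega⟩

theorem exists_of_flag (M : PolyModel α s n) (f : Flag α) :
    ∃ Φ : M.CF, ∀ x, x ∈ f ↔ ∃ k, Φ k = x := by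
  have h : ∀ k, ∃ x ∈ f, M.rho x = min k n := fun k => flag_rank M f (min_le_right _ _)
  choose g hg1 hg2 using h
  have htp : M.tp ∈ f := Flag.mem_iff_forall_le_or_ge.2 fun b _ => Or.inr (M.le_tp b)
  refine ⟨⟨g, fun k hk => flag_lt M f (hg1 _) (hg1 _) ?_, fun k hk => ?_⟩, fun x => ⟨fun hx => ?_, ?_⟩⟩
  · rw [hg2, hg2]; omega
  · refine flag_eq M f (hg1 _) htp ?_
    rw [hg2, M.rho_tp]; omega
  · refine ⟨M.rho x, flag_eq M f (hg1 _) hx ?_⟩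
    rw [hg2]
    exact min_eq_left (M.rho_le x)
  · rintro ⟨k, rfl⟩
    exact hg1 k

theorem exists_cf {a b : α} (M : PolyModel α s n) (h : a ≤ b) :
    ∃ Φ : M.CF, Φ (M.rho a) = a ∧ Φ (M.rho b) = b := by
  have hc : IsChain (· ≤ ·) ({a, b} : Set α) := by
    intro x hx y hy hxy
    simp only [Set.mem_insert_iff, Set.mem_singleton_iff] at hx hy
    rcases hx with rfl | rfl <;> rcases hy with rfl | rfl
    · exact absurd rfl hxy
    · exact Or.inl h
    · exact Or.inr h
    · exact absurd rfl hxy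
  obtain ⟨f, hf⟩ := hc.exists_subset_flag
  obtain ⟨Φ, hΦ⟩ := exists_of_flag M f
  have : ∀ x, x ∈ f → Φ (M.rho x) = x := by
    intro x hx
    refine flag_eq M f ((hΦ _).2 ⟨_, rfl⟩) hx ?_
    rw [Φ.rho (M.rho_le x)]
  exact ⟨Φ, this a (hf (by simp)), this b (hf (by simp))⟩

/-- The flag of a complete flag function. -/
noncomputable def toFlag (Φ : M.CF) : Flag α where
  carrier := Set.range Φ
  Chain' := by
    rintro _ ⟨j, rfl⟩ _ ⟨k, rfl⟩ _
    have : ∀ j k, j ≤ k → Φ j ≤ Φ k := by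
      intro j k hjk
      rcases le_total k n with h | h
      · exact Φ.le hjk h
      · rw [Φ.eq_tp h]
        exact M.le_tp _
    rcases le_total j k with h | h
    · exact Or.inl (this _ _ h)
    · exact Or.inr (this _ _ h)
  max_chain' := by
    intro t ht hst
    refine Set.Subset.antisymm hst fun x hx => ⟨M.rho x, ?_⟩
    have hk : Φ (M.rho x) ∈ t := hst ⟨_, rfl⟩
    by_contra hne
    have hr := Φ.rho (M.rho_le x)
    rcases ht hk hx hne with h | h
    · have := M.rho_lt (lt_of_le_of_ne h hne)
      omega
    · have := M.rho_lt (lt_of_le_of_ne h (Ne.symm hne))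
      omega

theorem mem_toFlag (Φ : M.CF) (x : α) : x ∈ toFlag Φ ↔ ∃ k, Φ k = x := Iff.rfl

theorem toFlag_surj (M : PolyModel α s n) (f : Flag α) : ∃ Φ : M.CF, toFlag Φ = f := by
  obtain ⟨Φ, h⟩ := exists_of_flag M f
  exact ⟨Φ, SetLike.ext fun x => (h x).symm⟩

theorem toFlag_mem_rank (Φ : M.CF) {x : α} (h : x ∈ toFlag Φ) : Φ (M.rho x) = x := by
  refine flag_eq M (toFlag Φ) ⟨_, rfl⟩ h ?_
  rw [Φ.rho (M.rho_le x)]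

theorem toFlag_inj {Φ Ψ : M.CF} (h : toFlag Φ = toFlag Ψ) : Φ = Ψ := by
  ext k
  rcases le_total k n with hk | hk
  · have h1 : Φ k ∈ toFlag Ψ := by rw [← h]; exact ⟨k, rfl⟩
    have := toFlag_mem_rank Ψ h1
    rw [Φ.rho hk] at this
    exact this.symm
  · rw [Φ.eq_tp hk, Ψ.eq_tp hk]

theorem map_tp (M : PolyModel α s n) (γ : α ≃o α) : γ M.tp = M.tp := by
  refine le_antisymm (M.le_tp _) ?_
  have := γ.monotone (M.le_tp (γ.symm M.tp))
  simpa using this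

/-- Automorphisms act on flags. -/
def act (γ : α ≃o α) (Φ : M.CF) : M.CF where
  toFun k := γ (Φ k)
  lt_succ' k hk := γ.strictMono (Φ.lt_succ hk)
  eq_tp' k hk := by rw [Φ.eq_tp hk, map_tp]

theorem act_apply (γ : α ≃o α) (Φ : M.CF) (k : ℕ) : act γ Φ k = γ (Φ k) := rfl

theorem act_sig (γ : α ≃o α) (i : ℕ) (hi : 0 < i ∧ i < n) (Φ : M.CF) :
    act γ (sig i Φ) = sig i (act γ Φ) := by
  rcases eq_or_eq (act γ Φ) (act γ (sig i Φ)) hi (fun k hk => by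
    rw [act_apply, act_apply, sig_of_ne _ hk]) with h | h
  · exfalso
    have h1 : act γ (sig i Φ) i = act γ Φ i := by rw [h]
    exact sig_self_ne Φ hi (γ.injective h1)
  · exact h

/-- Same orbit. -/
def SO (Φ Ψ : M.CF) : Prop := ∃ γ : α ≃o α, act γ Φ = Ψ

theorem SO.symm {Φ Ψ : M.CF} (h : SO Φ Ψ) : SO Ψ Φ := by
  obtain ⟨γ, rfl⟩ := h
  exact ⟨γ.symm, CF.ext fun k => by simp [act_apply]⟩

theorem SO.trans {Φ Ψ Ω : M.CF} (h : SO Φ Ψ) (h' : SO Ψ Ω) : SO Φ Ω := by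
  obtain ⟨γ, rfl⟩ := h
  obtain ⟨δ, rfl⟩ := h'
  exact ⟨γ.trans δ, rfl⟩

theorem sameFlagOrbit_iff (Φ Ψ : M.CF) : SameFlagOrbit (toFlag Φ) (toFlag Ψ) ↔ SO Φ Ψ := by
  constructor
  · rintro ⟨γ, h⟩
    refine ⟨γ, toFlag_inj (SetLike.ext fun x => ?_)⟩
    have : x ∈ (toFlag Ψ : Set α) ↔ x ∈ γ '' (toFlag Φ : Set α) := by rw [h]
    refine Iff.trans ?_ this.symm
    constructor
    · rintro ⟨k, rfl⟩
      exact ⟨Φ k, ⟨k, rfl⟩, rfl⟩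
    · rintro ⟨_, ⟨k, rfl⟩, rfl⟩
      exact ⟨k, rfl⟩
  · rintro ⟨γ, rfl⟩
    refine ⟨γ, Set.ext fun x => ?_⟩
    constructor
    · rintro ⟨_, ⟨k, rfl⟩, rfl⟩
      exact ⟨k, rfl⟩
    · rintro ⟨k, rfl⟩
      exact ⟨Φ k, ⟨k, rfl⟩, rfl⟩

theorem iter_act (γ : α ≃o α) {i j : ℕ} (hi : 0 < i ∧ i < n) (hj : 0 < j ∧ j < n) (k : ℕ)
    (Φ : M.CF) : (rr i j)^[k] (act γ Φ) = act γ ((rr i j)^[k] Φ) := by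
  have h : Function.Semiconj (act (M := M) γ) (rr i j) (rr i j) := fun x => by
    rw [rr, rr, act_sig _ _ hj, act_sig _ _ hi]
  exact ((h.iterate_right k) Φ).symm

/-- A bijection of the flags commuting with adjacency comes from an automorphism. -/
theorem exists_aut (σ : M.CF ≃ M.CF) (hσ : ∀ i, 0 < i ∧ i < n → ∀ Φ, σ (sig i Φ) = sig i (σ Φ)) :
    ∃ γ : α ≃o α, ∀ Φ, act γ Φ = σ Φ := by
  have hτ : ∀ i, 0 < i ∧ i < n → ∀ Φ, σ.symm (sig i Φ) = sig i (σ.symm Φ) := by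
    intro i hi Φ
    rw [Equiv.symm_apply_eq, hσ i hi, Equiv.apply_symm_apply]
  have wd : ∀ τ : M.CF → M.CF, (∀ i, 0 < i ∧ i < n → ∀ Φ, τ (sig i Φ) = sig i (τ Φ)) →
      ∀ k Φ Ψ, Φ k = Ψ k → τ Φ k = τ Ψ k := by
    intro τ hτ k Φ Ψ h
    refine residue (C := fun Ω => τ Φ k = τ Ω k) k (fun i hik hi Ω hΩ => ?_) Φ Ψ h rfl
    rw [hτ i hi, sig_of_ne _ hik.symm]
    exact hΩ
  choose fl hfl using fun a : α => exists_cf M (le_refl a)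
  have hg : ∀ τ : M.CF → M.CF, (∀ i, 0 < i ∧ i < n → ∀ Φ, τ (sig i Φ) = sig i (τ Φ)) →
      ∃ g : α → α, Monotone g ∧ ∀ Φ : M.CF, ∀ k, g (Φ k) = τ Φ k := by
    intro τ hτ
    have key : ∀ Φ : M.CF, ∀ k, τ (fl (Φ k)) (M.rho (Φ k)) = τ Φ k := by
      intro Φ k
      rcases le_total k n with hk | hk
      · have := (hfl (Φ k)).1
        rw [Φ.rho hk] at this ⊢
        exact wd τ hτ k _ _ this
      · rw [Φ.eq_tp hk, M.rho_tp, (τ Φ).eq_tp hk, CF.eq_tp _ le_rfl]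
    refine ⟨fun a => τ (fl a) (M.rho a), fun a b hab => ?_, key⟩
    obtain ⟨Φ, h1, h2⟩ := exists_cf M hab
    have k1 := key Φ (M.rho a)
    have k2 := key Φ (M.rho b)
    rw [h1] at k1
    rw [h2] at k2
    change τ (fl a) (M.rho a) ≤ τ (fl b) (M.rho b)
    rw [k1, k2]
    refine CF.le _ ?_ (M.rho_le b)
    rcases eq_or_lt_of_le hab with rfl | h
    · exact le_rfl
    · exact (M.rho_lt h).le
  obtain ⟨g, gm, hg1⟩ := hg σ hσ
  obtain ⟨g', gm', hg1'⟩ := hg σ.symm hτ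
  have e1 : ∀ a, g' (g a) = a := by
    intro a
    rw [← (hfl a).1, hg1, hg1', Equiv.symm_apply_apply]
  have e2 : ∀ a, g (g' a) = a := by
    intro a
    rw [← (hfl a).1, hg1', hg1, Equiv.apply_symm_apply]
  refine ⟨⟨⟨g, g', e1, e2⟩, ?_⟩, fun Φ => CF.ext fun k => hg1 Φ k⟩
  intro a b
  refine ⟨fun h => ?_, fun h => gm h⟩
  have := gm' h
  simpa [e1] using this

theorem regular (hE : ∀ i j, 0 < i ∧ i < n → 0 < j ∧ j < n → i ≠ j →
      ∀ k, ∀ Φ Ψ : M.CF, (rr i j)^[k] Φ = Φ → (rr i j)^[k] Ψ = Ψ) (Φ Ψ : M.CF) : SO Φ Ψ := by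
  obtain ⟨μ, hμ⟩ := exists_sigma hE Φ
  have h : ∀ Ω, SO μ Ω := by
    intro Ω
    obtain ⟨σ, h0, h1⟩ := hμ Ω
    have hsurj : Function.Surjective σ := by
      intro X
      refine connected (C := fun X => ∃ a, σ a = X) (fun i hi Φ hΦ => ?_) (σ μ) X ⟨μ, rfl⟩
      obtain ⟨a, rfl⟩ := hΦ
      exact ⟨sig i a, h1 i hi a⟩
    have hbij : Function.Bijective σ := Finite.surjective_iff_bijective.1 hsurj
    obtain ⟨γ, hγ⟩ := exists_aut (Equiv.ofBijective σ hbij) (fun i hi Φ => h1 i hi Φ)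
    exact ⟨γ, (hγ μ).trans h0⟩
  exact (h Φ).symm.trans (h Ψ)

end PolyModel

namespace PolyModel

variable {ι V : Type*} [Finite ι] [AddCommGroup V] [Module ℝ V] [FiniteDimensional ℝ V]
  {s : ι → V} {n : ℕ} {M : PolyModel α s n}

open CF

theorem sig_iter' (i j k : ℕ) (Φ : M.CF) :
    sig j ((rr i j)^[k] Φ) = (rr j i)^[k] (sig j Φ) := by
  have h : Function.Semiconj (sig (M := M) j) (rr i j) (rr j i) := fun x => by
    simp only [rr, sig_sig]
  exact (h.iterate_right k) Φ

theorem iter_inj_aux {i j q : ℕ} (hi : 0 < i ∧ i < n) (hj : 0 < j ∧ j < n)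
    (hq : ∀ Φ : M.CF, ∀ t, 0 < t → t < q → (rr i j)^[t] Φ ≠ Φ) (Φ : M.CF) {k k' : ℕ}
    (hk : k < q) (hk' : k' < q) (h : (rr i j)^[k] Φ = (rr i j)^[k'] Φ) : k = k' := by
  wlog hle : k ≤ k' generalizing k k'
  · exact (this hk' hk h.symm (by omega)).symm
  by_contra hne
  apply hq ((rr i j)^[k] Φ) (k' - k) (by omega) (by omega)
  rw [← Function.iterate_add_apply, show k' - k + k = k' by omega, h]

theorem iter_odd_aux {i j : ℕ} (hi : 0 < i ∧ i < n) (hj : 0 < j ∧ j < n) (Φ : M.CF) (k k' : ℕ) :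
    (rr i j)^[k] Φ ≠ sig i ((rr i j)^[k'] Φ) := by
  intro h
  rcases le_total k k' with hle | hle
  · apply sig_iter_ne hi hj (k' - k) ((rr i j)^[k] Φ)
    rw [← Function.iterate_add_apply, show k' - k + k = k' by omega, h]
  · apply sig_iter_ne hi hj (k - k') ((rr i j)^[k'] Φ)
    rw [← Function.iterate_add_apply, show k - k' + k' = k by omega, h, sig_sig]

theorem card_pairs {l : V →ₗ[ℝ] ℝ} (hl : ∀ Φ : M.CF, ∀ k, k < n → M.ht l Φ k ≠ 0) {i j q : ℕ}
    (hi : 0 < i ∧ i < n) (hj : 0 < j ∧ j < n) (hij : i ≠ j)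
    (hq : ∀ Φ : M.CF, ∀ t, 0 < t → t < q → (rr i j)^[t] Φ ≠ Φ) :
    2 * q * Nat.card {Φ : M.CF // desc l i Φ ∧ desc l j Φ} ≤ Nat.card M.CF := by
  let f : {Φ : M.CF // desc l i Φ ∧ desc l j Φ} × Fin q × Bool → M.CF := fun x =>
    if x.2.2 then sig i ((rr i j)^[x.2.1] x.1.1) else (rr i j)^[x.2.1] x.1.1
  have hoff : ∀ x, ∀ m, m ≠ i → m ≠ j → f x m = x.1.1 m := by
    intro x m h1 h2
    simp only [f]
    split_ifs
    · rw [sig_of_ne _ h1, rr_iter_of_ne h1 h2]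
    · rw [rr_iter_of_ne h1 h2]
  have hf : Function.Injective f := by
    intro x y hxy
    have h1 : x.1 = y.1 := by
      by_contra hne
      have hne' : x.1.1 ≠ y.1.1 := fun h => hne (Subtype.ext h)
      have hag : ∀ m, m ≠ i → m ≠ j → x.1.1 m = y.1.1 m := fun m a b => by
        rw [← hoff x m a b, ← hoff y m a b, hxy]
      have a1 := O2 hl x.1.1 y.1.1 hi hj hij x.1.2.1 x.1.2.2
        (fun m a b => (hag m a b).symm) (Ne.symm hne')
      have a2 := O2 hl y.1.1 x.1.1 hi hj hij y.1.2.1 y.1.2.2 hag hne'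
      exact lt_asymm a1 a2
    obtain ⟨Φ, k, b⟩ := x
    obtain ⟨Φ', k', b'⟩ := y
    obtain rfl : Φ = Φ' := h1
    have h2 : k = k' ∧ b = b' := by
      cases b <;> cases b'
      · exact ⟨Fin.ext (iter_inj_aux hi hj hq Φ.1 k.2 k'.2 hxy), rfl⟩
      · exact absurd hxy (iter_odd_aux hi hj Φ.1 k k')
      · exact absurd hxy.symm (iter_odd_aux hi hj Φ.1 k' k)
      · have h3 := congrArg (sig i) hxy
        simp only [f, if_true, sig_sig] at h3
        exact ⟨Fin.ext (iter_inj_aux hi hj hq Φ.1 k.2 k'.2 h3), rfl⟩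
    rw [h2.1, h2.2]
  have := Nat.card_le_card_of_injective f hf
  rw [Nat.card_prod, Nat.card_prod] at this
  simp only [Nat.card_eq_fintype_card, Fintype.card_fin, Fintype.card_bool] at this
  linarith

theorem card_desc {l : V →ₗ[ℝ] ℝ} (hl : ∀ Φ : M.CF, ∀ k, k < n → M.ht l Φ k ≠ 0) {i : ℕ}
    (hi : 0 < i ∧ i < n) :
    2 * Nat.card {Φ : M.CF // desc l i Φ} = Nat.card M.CF := by
  have e : {Φ : M.CF // desc l i Φ} ≃ {Φ : M.CF // ¬ desc l i Φ} :=
    { toFun := fun Φ => ⟨sig i Φ.1, fun h => (desc_sig hl Φ.1 hi).1 h Φ.2⟩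
      invFun := fun Φ => ⟨sig i Φ.1, (desc_sig hl Φ.1 hi).2 Φ.2⟩
      left_inv := fun Φ => Subtype.ext (sig_sig i Φ.1)
      right_inv := fun Φ => Subtype.ext (sig_sig i Φ.1) }
  have h1 := Nat.card_congr e
  have h2 := Nat.card_congr (Equiv.sumCompl (fun Φ : M.CF => desc l i Φ))
  rw [Nat.card_sum] at h2
  omega

/-- The counting lemma: three consecutive Schläfli numbers cannot all be large. -/
theorem counting (Φ₁ : M.CF) {i : ℕ} (hi : 0 < i) (hin : i + 2 < n)
    (h1 : ∀ Φ : M.CF, ∀ t, 0 < t → t < 4 → (rr i (i + 1))^[t] Φ ≠ Φ)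
    (h2 : ∀ Φ : M.CF, ∀ t, 0 < t → t < 4 → (rr (i + 1) (i + 2))^[t] Φ ≠ Φ) : False := by
  obtain ⟨l, hl⟩ := exists_generic M
  have : Nonempty M.CF := ⟨Φ₁⟩
  letI : Fintype M.CF := Fintype.ofFinite _
  obtain ⟨μ, -, hμ⟩ := (key_wf (M := M) l).has_min Set.univ Set.univ_nonempty
  have v0 : 0 < i ∧ i < n := by omega
  have v1 : 0 < i + 1 ∧ i + 1 < n := by omega
  have v2 : 0 < i + 2 ∧ i + 2 < n := by omega
  have a0 := card_desc hl v0
  have a1 := card_desc hl v1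
  have a2 := card_desc hl v2
  have b01 := card_pairs hl v0 v1 (by omega) h1
  have b12 := card_pairs hl v1 v2 (by omega) h2
  have b02 := card_pairs (q := 2) hl v0 v2 (by omega) (fun Φ t ht ht' => by
    obtain rfl : t = 1 := by omega
    exact rr_ne v0 (by omega) Φ)
  have cf : ∀ (p : M.CF → Prop) [DecidablePred p], (Nat.card {Φ // p Φ} : ℤ) = ∑ Φ, if p Φ then 1 else 0 := by
    intro p _
    rw [Finset.sum_boole, Nat.card_eq_fintype_card, Fintype.card_subtype]
  have hsum : (0 : ℤ) < ∑ Φ : M.CF, (1 - (if desc l i Φ then 1 else 0)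
      - (if desc l (i + 1) Φ then 1 else 0) - (if desc l (i + 2) Φ then 1 else 0)
      + (if desc l i Φ ∧ desc l (i + 1) Φ then 1 else 0)
      + (if desc l (i + 1) Φ ∧ desc l (i + 2) Φ then 1 else 0)
      + (if desc l i Φ ∧ desc l (i + 2) Φ then 1 else 0)) := by
    apply Finset.sum_pos'
    · intro Φ _
      by_cases c0 : desc l i Φ <;> by_cases c1 : desc l (i + 1) Φ <;>
        by_cases c2 : desc l (i + 2) Φ <;> simp [c0, c1, c2]
    · refine ⟨μ, Finset.mem_univ _, ?_⟩
      have hd : ∀ j, ¬ desc l j μ := fun j hd => hμ _ (Set.mem_univ _) hd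
      simp [hd]
  simp only [Finset.sum_add_distrib, Finset.sum_sub_distrib, ← cf] at hsum
  rw [Finset.sum_const, Finset.card_univ, ← Nat.card_eq_fintype_card] at hsum
  simp only [nsmul_eq_mul, mul_one] at hsum
  omega

/-- The combinatorial classification. -/
theorem classify (N : Set ℕ)
    (hN : ∀ Φ : M.CF, ∀ i, 0 < i ∧ i < n → (SO Φ (sig i Φ) ↔ i ∉ N))
    (Φa Φb : M.CF) (hab : ¬ SO Φa Φb) (htwo : ∀ Ω : M.CF, SO Ω Φa ∨ SO Ω Φb) :
    (∀ i, 0 < i ∧ i < n → (i ∈ N ↔ i = 1)) ∨ (∀ i, 0 < i ∧ i < n → (i ∈ N ↔ i = n - 1)) ∨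
      (n = 5 ∧ ∀ i, 0 < i ∧ i < n → (i ∈ N ↔ i = 1 ∨ i = 4)) := by
  have col1 : ∀ Ω i, 0 < i ∧ i < n → i ∈ N → (SO (sig i Ω) Φa ↔ ¬ SO Ω Φa) := by
    intro Ω i hi hiN
    have hns : ¬ SO Ω (sig i Ω) := fun h => (hN Ω i hi).1 h hiN
    constructor
    · exact fun h h' => hns (h'.trans h.symm)
    · intro h
      by_contra h'
      have k1 := (htwo Ω).resolve_left h
      have k2 := (htwo (sig i Ω)).resolve_left h'
      exact hns (k1.trans k2.symm)
  have col0 : ∀ Ω i, 0 < i ∧ i < n → i ∉ N → (SO (sig i Ω) Φa ↔ SO Ω Φa) := by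
    intro Ω i hi hiN
    have hs : SO Ω (sig i Ω) := (hN Ω i hi).2 hiN
    exact ⟨fun h => hs.trans h, fun h => hs.symm.trans h⟩
  have hne : ∃ i, (0 < i ∧ i < n) ∧ i ∈ N := by
    by_contra hcon
    push Not at hcon
    refine hab ?_
    have h := connected (C := fun Ω => SO Φa Ω) (fun i hi Ω h =>
      SO.symm ((col0 Ω i hi (hcon i hi)).2 h.symm)) Φa Φb ⟨OrderIso.refl α, rfl⟩
    exact h
  -- some pair is bad
  have hbad : ∃ i, 0 < i ∧ i + 1 < n ∧ ∀ j, 0 < j ∧ j < n → j ∈ N → j + 1 = i ∨ j = i + 2 := by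
    by_contra hcon
    push Not at hcon
    refine hab (regular ?_ Φa Φb)
    have hadj : ∀ i, 0 < i → i + 1 < n → ∀ k, ∀ Φ Ψ : M.CF, (rr i (i + 1))^[k] Φ = Φ →
        (rr i (i + 1))^[k] Ψ = Ψ := by
      intro i hi hin k Φ Ψ h
      obtain ⟨j, hj, hjN, hj1, hj2⟩ := hcon i hi hin
      have v0 : 0 < i ∧ i < n := by omega
      have v1 : 0 < i + 1 ∧ i + 1 < n := by omega
      have inv : ∀ X Y : M.CF, SO X Y → (rr i (i + 1))^[k] X = X → (rr i (i + 1))^[k] Y = Y := by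
        rintro X _ ⟨γ, rfl⟩ hX
        rw [iter_act γ v0 v1, hX]
      have hs : (rr i (i + 1))^[k] (sig j Φ) = sig j Φ := by
        by_cases c1 : j = i
        · subst c1
          rw [← sig_iter', rr_iter_swap h]
        by_cases c2 : j = i + 1
        · subst c2
          have := sig_iter (i + 1) i k Φ
          rw [← this, rr_iter_swap h]
        · have hc : Function.Semiconj (sig (M := M) j) (rr i (i + 1)) (rr i (i + 1)) := fun x => by
            rw [rr, rr, sig_comm' (by omega : j + 1 < i + 1 ∨ i + 1 + 1 < j),
              sig_comm' (by omega : j + 1 < i ∨ i + 1 < j)]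
          have := (hc.iterate_right k) Φ
          rw [← this, h]
      have hcol := col1 Φ j hj hjN
      by_cases hΨ : SO Ψ Φa ↔ SO Φ Φa
      · refine inv Φ Ψ ?_ h
        by_cases hc : SO Φ Φa
        · exact hc.trans (hΨ.2 hc).symm
        · exact ((htwo Φ).resolve_left hc).trans
            ((htwo Ψ).resolve_left (fun h => hc (hΨ.1 h))).symm
      · refine inv (sig j Φ) Ψ ?_ hs
        by_cases hc : SO Φ Φa
        · have k1 : ¬ SO Ψ Φa := fun h => hΨ ⟨fun _ => hc, fun _ => h⟩
          have k2 : ¬ SO (sig j Φ) Φa := fun h => hcol.1 h hc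
          exact ((htwo _).resolve_left k2).trans ((htwo Ψ).resolve_left k1).symm
        · have k1 : SO Ψ Φa := by
            by_contra k1
            exact hΨ ⟨fun h => absurd h k1, fun h => absurd h hc⟩
          exact (hcol.2 hc).trans k1.symm
    have hE' : ∀ i j, 0 < i ∧ i < n → 0 < j ∧ j < n → i < j →
        ∀ k, ∀ Φ Ψ : M.CF, (rr i j)^[k] Φ = Φ → (rr i j)^[k] Ψ = Ψ := by
      intro i j hi hj hij k Φ Ψ h
      by_cases hadj' : j = i + 1
      · subst hadj'
        exact hadj i hi.1 hj.2 k Φ Ψ h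
      · have h2 : (rr (M := M) i j)^[2] = id := by
          funext X
          change sig j (sig i (sig j (sig i X))) = X
          rw [sig_comm' (by omega : i + 1 < j ∨ j + 1 < i), sig_sig, sig_sig]
        rcases Nat.even_or_odd' k with ⟨m, rfl | rfl⟩
        · rw [Function.iterate_mul, h2, Function.iterate_id]; rfl
        · exfalso
          rw [Function.iterate_succ_apply, Function.iterate_mul, h2, Function.iterate_id] at h
          exact rr_ne hi (by omega) Φ h
    intro i j hi hj hij k Φ Ψ h
    rcases lt_or_gt_of_ne hij with hlt | hlt
    · exact hE' i j hi hj hlt k Φ Ψ h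
    · exact rr_iter_swap (hE' j i hj hi hlt k Φ Ψ (rr_iter_swap h))
  obtain ⟨i, hi, hin, hbad⟩ := hbad
  have hflip : ∀ a, 0 < a → a + 1 < n → (a ∈ N ↔ ¬ a + 1 ∈ N) → ∀ Φ : M.CF, ∀ t, 0 < t → t < 4 →
      (rr a (a + 1))^[t] Φ ≠ Φ := by
    intro a ha han hx Φ t ht ht' h
    have hr : ∀ X : M.CF, SO (rr a (a + 1) X) Φa ↔ ¬ SO X Φa := by
      intro X
      rw [rr]
      by_cases hc : a ∈ N
      · rw [col0 _ _ (by omega) (hx.1 hc), col1 _ _ (by omega) hc]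
      · rw [col1 _ _ (by omega) (by tauto), col0 _ _ (by omega) hc]
    obtain rfl | rfl | rfl : t = 1 ∨ t = 2 ∨ t = 3 := by omega
    · exact rr_ne (by omega) (by omega) Φ h
    · exact rr_two_ne ha han Φ h
    · have h3 : rr a (a + 1) (rr a (a + 1) (rr a (a + 1) Φ)) = Φ := h
      have := hr (rr a (a + 1) (rr a (a + 1) Φ))
      rw [h3, hr, hr] at this
      tauto
  have hinterior : ∀ j, j ∈ N → 1 < j → j + 1 < n → False := by
    intro j hj h1 h2
    obtain ⟨a, rfl⟩ : ∃ a, j = a + 1 := ⟨j - 1, by omega⟩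
    have hb := hbad (a + 1) (by omega) hj
    have n1 : a ∉ N := fun h => by
      have := hbad a (by omega) h
      omega
    have n2 : a + 2 ∉ N := fun h => by
      have := hbad (a + 2) (by omega) h
      omega
    exact counting Φa (by omega : 0 < a) (by omega) (hflip a (by omega) (by omega) (by tauto))
      (hflip (a + 1) (by omega) (by omega) (by tauto))
  have hend : ∀ j, 0 < j ∧ j < n → j ∈ N → j = 1 ∨ j = n - 1 := by
    intro j hj hjN
    by_contra hcon
    exact hinterior j hjN (by omega) (by omega)
  by_cases c1 : 1 ∈ N
  · by_cases c2 : n - 1 ∈ N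
    · have k1 := hbad 1 (by omega) c1
      have k2 := hbad (n - 1) (by omega) c2
      by_cases hn2 : n = 5
      · right; right
        refine ⟨hn2, fun j hj => ⟨fun h => ?_, ?_⟩⟩
        · have := hend j hj h
          omega
        · rintro (rfl | rfl)
          · exact c1
          · rw [hn2] at c2; exact c2
      · exfalso; omega
    · left
      refine fun j hj => ⟨fun h => ?_, fun h => h ▸ c1⟩
      rcases hend j hj h with h' | h'
      · exact h'
      · exact absurd (h' ▸ h) c2
  · right; left
    refine fun j hj => ⟨fun h => ?_, fun h => ?_⟩
    · rcases hend j hj h with h' | h'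
      · exact absurd (h' ▸ h) c1
      · exact h'
    · obtain ⟨m, hm, hmN⟩ := hne
      rcases hend m hm hmN with h' | h'
      · exact absurd (h' ▸ hmN) c1
      · rw [h, ← h']; exact hmN

end PolyModel

theorem exposed_subset_hull {d : ℕ} (S : Finset (EucSp d)) {F : Set (EucSp d)}
    (hF : IsExposed ℝ (convexHull ℝ (S : Set (EucSp d))) F) :
    F ⊆ convexHull ℝ ((S : Set (EucSp d)) ∩ F) := by
  have hP : IsCompact (convexHull ℝ (S : Set (EucSp d))) := S.finite_toSet.isCompact_convexHull ℝ
  have hc : IsCompact F := hF.isCompact hP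
  have hcv : Convex ℝ F := hF.convex (convex_convexHull ℝ _)
  have h1 := closure_convexHull_extremePoints hc hcv
  have h2 : F.extremePoints ℝ ⊆ (S : Set (EucSp d)) ∩ F := fun x hx =>
    ⟨extremePoints_convexHull_subset (hF.isExtreme.extremePoints_subset_extremePoints hx), hx.1⟩
  have h3 : IsClosed (convexHull ℝ ((S : Set (EucSp d)) ∩ F)) :=
    ((S.finite_toSet.subset Set.inter_subset_left).isCompact_convexHull ℝ).isClosed
  conv_lhs => rw [← h1]
  exact closure_minimal (convexHull_mono h2) h3

theorem affine_hull_nonneg {d : ℕ} (S : Set (EucSp d)) (f : EucSp d × ℝ →ₗ[ℝ] ℝ)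
    (hf : ∀ x ∈ S, 0 ≤ f (x, 1)) : ∀ x ∈ convexHull ℝ S, 0 ≤ f (x, 1) := by
  have hc : Convex ℝ {x : EucSp d | 0 ≤ f (x, 1)} := by
    intro x hx y hy a b ha hb hab
    have : ((a • x + b • y, 1) : EucSp d × ℝ) = a • (x, 1) + b • (y, 1) := by
      ext
      · simp
      · simp [hab]
    change 0 ≤ f (a • x + b • y, 1)
    rw [this, map_add, map_smul, map_smul]
    exact add_nonneg (mul_nonneg ha hx) (mul_nonneg hb hy)
  exact fun x hx => convexHull_min (s := S) (t := {x : EucSp d | 0 ≤ f (x, 1)}) hf hc hx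

theorem exists_face_functional {d : ℕ} (P : Set (EucSp d)) (F : Faces P) :
    ∃ m : EucSp d × ℝ →ₗ[ℝ] ℝ, ∀ x ∈ P, 0 ≤ m (x, 1) ∧ (m (x, 1) = 0 ↔ x ∈ F.1) := by
  rcases F.1.eq_empty_or_nonempty with h | h
  · refine ⟨LinearMap.snd ℝ _ _, fun x _ => ?_⟩
    rw [h]
    simp
  · obtain ⟨l, hl⟩ := F.2 h
    obtain ⟨x0, hx0⟩ := h
    have hx0' : x0 ∈ P ∧ ∀ y ∈ P, l y ≤ l x0 := by rw [hl] at hx0; exact hx0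
    refine ⟨(l x0) • LinearMap.snd ℝ (EucSp d) ℝ - (l : EucSp d →ₗ[ℝ] ℝ).comp (LinearMap.fst ℝ (EucSp d) ℝ),
      fun x hx => ?_⟩
    have e : ((l x0) • LinearMap.snd ℝ (EucSp d) ℝ -
        (l : EucSp d →ₗ[ℝ] ℝ).comp (LinearMap.fst ℝ (EucSp d) ℝ)) (x, 1) = l x0 - l x := by simp
    rw [e]
    refine ⟨sub_nonneg.2 (hx0'.2 x hx), fun h0 => ?_, fun hxF => ?_⟩
    · rw [hl]
      refine ⟨hx, fun y hy => ?_⟩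
      have := hx0'.2 y hy
      linarith
    · rw [hl] at hxF
      have h1 := hxF.2 x0 hx0'.1
      have h2 := hx0'.2 x hx
      linarith

theorem split_one {d : ℕ} (f : EucSp d × ℝ →ₗ[ℝ] ℝ) (x : EucSp d) :
    f (x, 1) = f (x, 0) + f (0, 1) := by
  rw [← map_add]; simp

theorem zero_set_exposed {d : ℕ} (P : Set (EucSp d)) (f : EucSp d × ℝ →ₗ[ℝ] ℝ)
    (hf : ∀ x ∈ P, 0 ≤ f (x, 1)) : IsExposed ℝ P {x ∈ P | f (x, 1) = 0} := by
  rintro ⟨x0, hx0, hx0'⟩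
  refine ⟨-LinearMap.toContinuousLinearMap (f.comp (LinearMap.inl ℝ (EucSp d) ℝ)), ?_⟩
  ext x
  simp only [Set.mem_ofPred_eq, neg_apply,
    LinearMap.coe_toContinuousLinearMap', LinearMap.comp_apply, LinearMap.inl_apply, neg_le_neg_iff]
  refine and_congr_right fun hx => ⟨fun h y hy => ?_, fun h => ?_⟩
  · have := hf y hy
    have e1 := split_one f x
    have e2 := split_one f y
    linarith
  · have := h x0 hx0
    have := hf x hx
    have e1 := split_one f x
    have e2 := split_one f x0
    linarith

theorem span_lift {d : ℕ} (S : Finset (EucSp d))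
    (hinterior : (interior (convexHull ℝ (S : Set (EucSp d)))).Nonempty) :
    Submodule.span ℝ (Set.range fun p : S => ((p.1, 1) : EucSp d × ℝ)) = ⊤ := by
  by_contra hne
  obtain ⟨f, hf0, hf⟩ := Submodule.exists_le_ker_of_lt_top _ (lt_top_iff_ne_top.2 hne)
  have hS : ∀ x ∈ (S : Set (EucSp d)), f (x, 1) = 0 := fun x hx =>
    hf (Submodule.subset_span ⟨⟨x, hx⟩, rfl⟩)
  have hP : ∀ x ∈ convexHull ℝ (S : Set (EucSp d)), f (x, 1) = 0 := fun x hx => by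
    have h1 := affine_hull_nonneg (S : Set (EucSp d)) f (fun x hx => (hS x hx).ge) x hx
    have h2 := affine_hull_nonneg (S : Set (EucSp d)) (-f)
      (fun x hx => by simp [hS x hx]) x hx
    simp only [LinearMap.neg_apply] at h2
    linarith
  obtain ⟨x0, hx0⟩ := hinterior
  have hv : ∀ v : EucSp d, f (v, 0) = 0 := by
    intro v
    have hcont : Filter.Tendsto (fun ε : ℝ => x0 + ε • v) (nhdsWithin 0 (Set.Ioi 0)) (nhds x0) := by
      have : Continuous fun ε : ℝ => x0 + ε • v := by fun_prop
      have h := this.tendsto 0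
      simp only [zero_smul, add_zero] at h
      exact h.mono_left nhdsWithin_le_nhds
    have h1 := hcont.eventually (isOpen_interior.mem_nhds hx0)
    obtain ⟨ε, hε, hε0⟩ := (h1.and self_mem_nhdsWithin).exists
    have k1 := hP _ (interior_subset hε)
    have k2 := hP _ (interior_subset hx0)
    have e : ((x0 + ε • v, 1) : EucSp d × ℝ) = (x0, 1) + ε • (v, 0) := by ext <;> simp
    rw [e, map_add, k2, map_smul, zero_add, smul_eq_mul] at k1
    exact (mul_eq_zero.1 k1).resolve_left (ne_of_gt hε0)
  apply hf0
  have h01 : f (0, 1) = 0 := by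
    have := split_one f x0
    rw [hP _ (interior_subset hx0), hv] at this
    linarith
  refine LinearMap.ext fun ⟨x, t⟩ => ?_
  have e : ((x, t) : EucSp d × ℝ) = (x, 0) + t • (0, 1) := by ext <;> simp
  rw [e, map_add, map_smul, hv, h01]
  simp

theorem exists_model {d : ℕ} (S : Finset (EucSp d))
    (hinterior : (interior (convexHull ℝ (S : Set (EucSp d)))).Nonempty) :
    Nonempty (PolyModel (Faces (convexHull ℝ (S : Set (EucSp d))))
      (fun p : S => ((p.1, 1) : EucSp d × ℝ)) (d + 1)) := by
  choose m hm using exists_face_functional (convexHull ℝ (S : Set (EucSp d)))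
  have hSP : ∀ p : S, p.1 ∈ convexHull ℝ (S : Set (EucSp d)) := fun p => subset_convexHull ℝ _ p.2
  refine ⟨{
    T := fun F => {p | p.1 ∈ F.1}
    le_iff := fun F G => ⟨fun h p hp => h hp, fun h => ?_⟩
    m := m
    m_nonneg := fun F p => (hm F p.1 (hSP p)).1
    m_zero := fun F p => (hm F p.1 (hSP p)).2
    surj := fun f hf => ?_
    hbot := ⟨LinearMap.snd ℝ _ _, fun p => by simp⟩
    htop := ?_ }⟩
  · intro x hx
    have h1 := exposed_subset_hull S F.2 hx
    refine convexHull_min ?_ (G.2.convex (convex_convexHull ℝ _)) h1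
    rintro y ⟨hy1, hy2⟩
    exact h (show (⟨y, hy1⟩ : S) ∈ {p : S | p.1 ∈ F.1} from hy2)
  · have hf' := affine_hull_nonneg (S : Set (EucSp d)) f (fun x hx => hf ⟨x, hx⟩)
    refine ⟨⟨_, zero_set_exposed _ f hf'⟩, fun p => ⟨fun h => h.2, fun h => ⟨hSP p, h⟩⟩⟩
  · rw [span_lift S hinterior, finrank_top]
    simp

theorem faceRank_lt {d : ℕ} {P : Set (EucSp d)} {F G : Faces P} (h : F < G) :
    faceRank F < faceRank G := by
  have hsub : F.1 ⊆ G.1 := h.le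
  have hnot : ¬ G.1 ⊆ F.1 := fun hh => h.not_ge hh
  obtain ⟨y, hyG, hyF⟩ := Set.not_subset.1 hnot
  have hG : G.1 ≠ ∅ := fun hh => by rw [hh] at hyG; exact hyG
  unfold faceRank
  rw [if_neg hG]
  split_ifs with hF
  · omega
  · have hFne := Set.nonempty_iff_ne_empty.2 hF
    obtain ⟨l, hl⟩ := F.2 hFne
    obtain ⟨x0, hx0⟩ := hFne
    have hx0' : x0 ∈ P ∧ ∀ y ∈ P, l y ≤ l x0 := by rw [hl] at hx0; exact hx0
    have hGP : G.1 ⊆ P := G.2.subset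
    have hle : affineSpan ℝ F.1 ≤ affineSpan ℝ G.1 := affineSpan_mono ℝ hsub
    have hyn : y ∉ affineSpan ℝ F.1 := by
      intro hy
      have hQ : affineSpan ℝ F.1 ≤ AffineSubspace.mk' x0 (LinearMap.ker (l : EucSp d →ₗ[ℝ] ℝ)) := by
        rw [affineSpan_le]
        intro z hz
        have hz' : z ∈ P ∧ ∀ y ∈ P, l y ≤ l z := by rw [hl] at hz; exact hz
        have h1 := hz'.2 x0 hx0'.1
        have h2 := hx0'.2 z hz'.1
        rw [SetLike.mem_coe, AffineSubspace.mem_mk', LinearMap.mem_ker]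
        simp only [vsub_eq_sub, map_sub, ContinuousLinearMap.coe_coe]
        linarith
      have h1 := hQ hy
      rw [AffineSubspace.mem_mk', LinearMap.mem_ker] at h1
      simp only [vsub_eq_sub, map_sub, ContinuousLinearMap.coe_coe] at h1
      apply hyF
      rw [hl]
      refine ⟨hGP hyG, fun z hz => ?_⟩
      have := hx0'.2 z hz
      linarith
    have hlt : affineSpan ℝ F.1 < affineSpan ℝ G.1 :=
      lt_of_le_of_ne hle fun he => hyn (he ▸ subset_affineSpan ℝ _ hyG)
    have := AffineSubspace.direction_lt_of_nonempty hlt ⟨x0, subset_affineSpan ℝ _ hx0⟩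
    exact_mod_cast Submodule.finrank_lt_finrank_of_lt this

theorem faceRank_ge {d : ℕ} {P : Set (EucSp d)} (F : Faces P) : -1 ≤ faceRank F := by
  unfold faceRank
  split_ifs <;> omega

theorem faceRank_le {d : ℕ} {P : Set (EucSp d)} (F : Faces P) : faceRank F ≤ d := by
  unfold faceRank
  split_ifs
  · omega
  · have := Submodule.finrank_le (affineSpan ℝ F.1).direction
    simp only [finrank_euclideanSpace, Fintype.card_fin] at this
    exact_mod_cast this

theorem faceRank_cf {d : ℕ} {P : Set (EucSp d)} {ι V : Type*} [Finite ι] [AddCommGroup V]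
    [Module ℝ V] [FiniteDimensional ℝ V] {s : ι → V} {M : PolyModel (Faces P) s (d + 1)}
    (Φ : M.CF) {k : ℕ} (hk : k ≤ d + 1) : faceRank (Φ k) = (k : ℤ) - 1 := by
  have h1 : ∀ k : ℕ, k ≤ d + 1 → (k : ℤ) - 1 ≤ faceRank (Φ k) := by
    intro k
    induction k with
    | zero => intro _; exact faceRank_ge _
    | succ k ih =>
      intro hk
      have := ih (by omega)
      have := faceRank_lt (Φ.lt_succ (k := k) (by omega))
      push_cast
      omega
  have h2 : ∀ j : ℕ, j ≤ d + 1 → faceRank (Φ (d + 1 - j)) ≤ (d : ℤ) - j := by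
    intro j
    induction j with
    | zero => intro _; have := faceRank_le (Φ (d + 1 - 0)); simpa using this
    | succ j ih =>
      intro hj
      have := ih (by omega)
      have h3 := faceRank_lt (Φ.lt_succ (k := d + 1 - (j + 1)) (by omega))
      rw [show d + 1 - (j + 1) + 1 = d + 1 - j by omega] at h3
      rw [Nat.cast_succ]
      omega
  have h3 := h2 (d + 1 - k) (by omega)
  rw [show d + 1 - (d + 1 - k) = k by omega] at h3
  have := h1 k hk
  omega

theorem isIAdjacent_sig {d : ℕ} {P : Set (EucSp d)} {ι V : Type*} [Finite ι] [AddCommGroup V]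
    [Module ℝ V] [FiniteDimensional ℝ V] {s : ι → V} {M : PolyModel (Faces P) s (d + 1)}
    (Φ : M.CF) {i : ℕ} (hi : i < d) :
    IsIAdjacent (faceRank (P := P)) i (PolyModel.toFlag Φ)
      (PolyModel.toFlag (PolyModel.CF.sig (i + 1) Φ)) := by
  refine ⟨fun h => ?_, fun x hx => ?_⟩
  · exact PolyModel.CF.sig_ne Φ (i := i + 1) (by omega) (PolyModel.toFlag_inj h).symm
  · have key : ∀ Ψ : M.CF, x ∈ PolyModel.toFlag Ψ → M.rho x ≠ i + 1 ∧ Ψ (M.rho x) = x := by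
      intro Ψ h
      have h1 := PolyModel.toFlag_mem_rank Ψ h
      refine ⟨fun h2 => hx ?_, h1⟩
      have := faceRank_cf Ψ (M.rho_le x)
      rw [h1, h2] at this
      rw [this]
      push_cast
      ring
    constructor
    · intro h
      obtain ⟨a, b⟩ := key _ h
      exact ⟨M.rho x, (PolyModel.CF.sig_of_ne Φ a).trans b⟩
    · intro h
      obtain ⟨a, b⟩ := key _ h
      exact ⟨M.rho x, (PolyModel.CF.sig_of_ne Φ a).symm.trans b⟩

/-- If `P` is a combinatorially two-orbit convex `d`-polytope of class
`2_I`, then `I = {0, 1, …, d-2}`, or `I = {1, 2, …, d-1}`, or `d = 4` and `I = {1, 2}`. -/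
theorem two_orbit_class_classification {d : ℕ} (P : Set (EucSp d)) (hP : IsConvexPolytope P)
    (I : Set ℕ) (hI : I ⊆ Set.Iio d)
    (h2 : InClass (faceRank (P := P)) d I) :
    I = Set.Iio (d - 1) ∨ I = Set.Ioo 0 d ∨ (d = 4 ∧ I = {1, 2}) := by
  obtain ⟨⟨S, rfl⟩, hinterior⟩ := hP
  obtain ⟨M⟩ := exists_model S hinterior
  obtain ⟨⟨f, g, hfg, htwo⟩, hcl⟩ := h2
  obtain ⟨Φa, rfl⟩ := PolyModel.toFlag_surj M f
  obtain ⟨Φb, rfl⟩ := PolyModel.toFlag_surj M g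
  have hcl' : ∀ Φ : M.CF, ∀ i, i < d →
      (PolyModel.SO Φ (PolyModel.CF.sig (i + 1) Φ) ↔ i ∈ I) := by
    intro Φ i hi
    rw [← PolyModel.sameFlagOrbit_iff]
    exact hcl _ _ i hi (isIAdjacent_sig Φ hi)
  have h := PolyModel.classify (M := M) {i | i - 1 ∉ I} (fun Φ i hi => by
    have := hcl' Φ (i - 1) (by omega)
    rw [show i - 1 + 1 = i by omega] at this
    simpa using this) Φa Φb (fun h => hfg ((PolyModel.sameFlagOrbit_iff _ _).2 h))
    (fun Ω => (htwo (PolyModel.toFlag Ω)).imp (PolyModel.sameFlagOrbit_iff _ _).1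
      (PolyModel.sameFlagOrbit_iff _ _).1)
  have hI' : ∀ x, x ∈ I → x < d := fun x hx => hI hx
  rcases h with h | h | ⟨hd, h⟩
  · right; left
    ext x
    have hx := h (x + 1)
    have := hI' x
    simp only [Set.mem_ofPred_eq, Nat.add_sub_cancel] at hx
    simp only [Set.mem_Ioo]
    by_cases hxd : x < d
    · have := hx (by omega)
      by_cases hxI : x ∈ I
      · simp only [hxI, true_iff]; constructor
        · by_contra h0
          exact (this.2 (by omega)) hxI
        · exact hxd
      · simp only [hxI, false_iff]
        have := this.1 hxI
        omega
    · have hxI : x ∉ I := fun h => hxd (hI' x h)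
      simp only [hxI, false_iff]
      omega
  · left
    ext x
    have hx := h (x + 1)
    simp only [Set.mem_ofPred_eq, Nat.add_sub_cancel] at hx
    simp only [Set.mem_Iio]
    by_cases hxd : x < d
    · have := hx (by omega)
      by_cases hxI : x ∈ I
      · simp only [hxI, true_iff]
        by_contra h0
        exact (this.2 (by omega)) hxI
      · simp only [hxI, false_iff]
        have := this.1 hxI
        omega
    · have hxI : x ∉ I := fun h => hxd (hI' x h)
      simp only [hxI, false_iff]
      omega
  · right; right
    refine ⟨by omega, ?_⟩
    ext x
    have hx := h (x + 1)
    simp only [Set.mem_ofPred_eq, Nat.add_sub_cancel] at hx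
    simp only [Set.mem_insert_iff, Set.mem_singleton_iff]
    by_cases hxd : x < d
    · have := hx (by omega)
      by_cases hxI : x ∈ I
      · simp only [hxI, true_iff]
        by_contra h0
        exact (this.2 (by omega)) hxI
      · simp only [hxI, false_iff]
        have := this.1 hxI
        omega
    · have hxI : x ∉ I := fun h => hxd (hI' x h)
      simp only [hxI, false_iff]
      omega
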